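/- Let n ≥ 1 and let w ∈ S_n be a permutation such that 𝔖_w is multiplicity-free. Let γ ∈ ℕ^n be the componentwise maximum of the (finite, nonempty) set supp(𝔊_w), and let P_w be the poset {β ∈ ℕ^n : α ≤ β ≤ γ componentwise for some α ∈ supp(𝔊_w)} together with an adjoined minimum element 0̂, ordered componentwise on integer vectors. Let μ_w denote the Möbius function of P_w, i.e. μ_w(0̂,0̂) = 1 and ∑_{q ≤ p} μ_w(0̂,q) = 0 for every p ∈ P_w with p ≠ 0̂. Then 𝔊_w = −∑_{β ∈ P_w∖{0̂}} μ_w(0̂, β) x^β. -/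

import Mathlib

open scoped Classical
open MvPolynomial

noncomputable section

/-- `S` is the family of Schubert polynomials for `S_n` (indexing variables by `Fin n`,
so the vector `(a_1, …, a_n)` corresponds to `a : Fin n →₀ ℕ`): the polynomial of the
longest element `w₀` (given by `Fin.revPerm`) is `x_1^{n-1} x_2^{n-2} ⋯ x_{n-1}`, and
whenever `w i > w (i+1)` we have `S (w * s_i) = ∂_i (S w)`, i.e.
`(x_i - x_{i+1}) * S (w * s_i) = S w - s_i (S w)`. -/
def IsSchubertFamily {n : ℕ} (S : Equiv.Perm (Fin n) → MvPolynomial (Fin n) ℤ) : Prop :=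
  S Fin.revPerm = ∏ i : Fin n, X i ^ (Fin.rev i : ℕ) ∧
    ∀ (w : Equiv.Perm (Fin n)) (i j : Fin n), (j : ℕ) = (i : ℕ) + 1 → w j < w i →
      (X i - X j) * S (w * Equiv.swap i j) = S w - rename (Equiv.swap i j) (S w)

/-- `G` is the family of Grothendieck polynomials for `S_n`:
`G w₀ = x_1^{n-1} x_2^{n-2} ⋯ x_{n-1}`, and whenever `w i > w (i+1)` we have
`G (w * s_i) = π_i (G w)` where `π_i f = ∂_i ((1 - x_{i+1}) f)`, i.e.
`(x_i - x_{i+1}) * G (w * s_i) = (1 - x_{i+1}) * G w - s_i ((1 - x_{i+1}) * G w)`. -/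
def IsGrothendieckFamily {n : ℕ} (G : Equiv.Perm (Fin n) → MvPolynomial (Fin n) ℤ) : Prop :=
  G Fin.revPerm = ∏ i : Fin n, X i ^ (Fin.rev i : ℕ) ∧
    ∀ (w : Equiv.Perm (Fin n)) (i j : Fin n), (j : ℕ) = (i : ℕ) + 1 → w j < w i →
      (X i - X j) * G (w * Equiv.swap i j) =
        (1 - X j) * G w - rename (Equiv.swap i j) ((1 - X j) * G w)

/-- The sum of the coefficients of a polynomial over the exponent vectors satisfying `P`. -/
def coeffSum {n : ℕ} (P : (Fin n → ℤ) → Prop) : MvPolynomial (Fin n) ℤ →ₗ[ℤ] ℤ :=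
  (basisMonomials (Fin n) ℤ).constr ℤ fun m => if P (fun i => (m i : ℤ)) then 1 else 0

section CoeffSum

variable {n : ℕ}

lemma coeffSum_monomial (P : (Fin n → ℤ) → Prop) (m : Fin n →₀ ℕ) (c : ℤ) :
    coeffSum P (monomial m c) = if P (fun i => (m i : ℤ)) then c else 0 := by
  have h : monomial m c = c • (basisMonomials (Fin n) ℤ) m := by
    simp [coe_basisMonomials, smul_monomial]
  rw [h, map_smul, coeffSum, Module.Basis.constr_basis]
  split_ifs <;> simp

lemma coeffSum_eq_sum (P : (Fin n → ℤ) → Prop) (f : MvPolynomial (Fin n) ℤ) :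
    coeffSum P f = ∑ m ∈ f.support, if P (fun i => (m i : ℤ)) then f.coeff m else 0 := by
  conv_lhs => rw [f.as_sum, map_sum]
  exact Finset.sum_congr rfl fun m _ => coeffSum_monomial P m _

lemma coeffSum_X_mul (P : (Fin n → ℤ) → Prop) (i : Fin n) (f : MvPolynomial (Fin n) ℤ) :
    coeffSum P (X i * f) = coeffSum (fun x => P (x + Pi.single i 1)) f := by
  induction f using MvPolynomial.induction_on' with
  | monomial m c =>
    have hm : (fun k => ((Finsupp.single i 1 + m : Fin n →₀ ℕ) k : ℤ)) =
        (fun k => (m k : ℤ)) + Pi.single i 1 := by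
      funext k
      by_cases hk : k = i
      · subst hk; simp [add_comm]
      · simp [hk]
    rw [X, monomial_mul, one_mul, coeffSum_monomial, coeffSum_monomial, hm]
  | add f g hf hg => rw [mul_add, map_add, map_add, hf, hg]

lemma coeffSum_rename_swap (P : (Fin n → ℤ) → Prop) (i j : Fin n) (f : MvPolynomial (Fin n) ℤ) :
    coeffSum P (rename (Equiv.swap i j) f) = coeffSum (fun x => P (x ∘ Equiv.swap i j)) f := by
  induction f using MvPolynomial.induction_on' with
  | monomial m c =>
    have hm : (fun k => (((Finsupp.mapDomain (Equiv.swap i j) m) k : ℕ) : ℤ)) =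
        (fun k => (m k : ℤ)) ∘ Equiv.swap i j := by
      funext k
      have := Finsupp.mapDomain_apply (Equiv.swap i j).injective m (Equiv.swap i j k)
      rw [Equiv.swap_apply_self] at this
      simp [this]
    rw [rename_monomial, coeffSum_monomial, coeffSum_monomial, hm]
  | add f g hf hg => rw [map_add, map_add, map_add, hf, hg]

/-- The coefficient function of a polynomial, extended by zero to integer vectors. -/
def intCoeff (f : MvPolynomial (Fin n) ℤ) (x : Fin n → ℤ) : ℤ := coeffSum (fun y => y = x) f

/-- The sum of the coefficients of a polynomial below an integer vector. -/
def cumCoeff (f : MvPolynomial (Fin n) ℤ) (x : Fin n → ℤ) : ℤ := coeffSum (fun y => y ≤ x) f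

lemma intCoeff_natCast (f : MvPolynomial (Fin n) ℤ) (m : Fin n →₀ ℕ) :
    intCoeff f (fun i => (m i : ℤ)) = f.coeff m := by
  have h : ∀ k : Fin n →₀ ℕ, ((fun i => (k i : ℤ)) = fun i => (m i : ℤ)) ↔ k = m := fun k => by
    simp [funext_iff, Finsupp.ext_iff]
  simp only [intCoeff, coeffSum_eq_sum, h, Finset.sum_ite_eq', mem_support_iff]
  split_ifs with h0
  · rfl
  · exact (not_not.mp h0).symm

lemma intCoeff_of_neg (f : MvPolynomial (Fin n) ℤ) {x : Fin n → ℤ} {i : Fin n} (hx : x i < 0) :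
    intCoeff f x = 0 := by
  rw [intCoeff, coeffSum_eq_sum]
  refine Finset.sum_eq_zero fun m _ => if_neg ?_
  rintro rfl
  simp at hx
  omega

lemma cumCoeff_of_neg (f : MvPolynomial (Fin n) ℤ) {x : Fin n → ℤ} {i : Fin n} (hx : x i < 0) :
    cumCoeff f x = 0 := by
  rw [cumCoeff, coeffSum_eq_sum]
  refine Finset.sum_eq_zero fun m _ => if_neg fun h => ?_
  have := h i
  simp at this
  omega

lemma exists_natCast_of_intCoeff_ne_zero {f : MvPolynomial (Fin n) ℤ} {x : Fin n → ℤ}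
    (hx : intCoeff f x ≠ 0) : ∃ m : Fin n →₀ ℕ, x = fun i => (m i : ℤ) := by
  refine ⟨Finsupp.equivFunOnFinite.symm fun i => (x i).toNat, funext fun i => ?_⟩
  have : 0 ≤ x i := by
    by_contra h
    exact hx (intCoeff_of_neg f (i := i) (by omega))
  simp [this]

lemma intCoeff_X_mul (i : Fin n) (f : MvPolynomial (Fin n) ℤ) (x : Fin n → ℤ) :
    intCoeff (X i * f) x = intCoeff f (x - Pi.single i 1) := by
  simp only [intCoeff, coeffSum_X_mul, eq_sub_iff_add_eq]

lemma cumCoeff_X_mul (i : Fin n) (f : MvPolynomial (Fin n) ℤ) (x : Fin n → ℤ) :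
    cumCoeff (X i * f) x = cumCoeff f (x - Pi.single i 1) := by
  simp only [cumCoeff, coeffSum_X_mul, le_sub_iff_add_le]

lemma comp_swap_comp_swap (i j : Fin n) (x : Fin n → ℤ) :
    (x ∘ Equiv.swap i j) ∘ Equiv.swap i j = x := by
  funext k; simp

lemma intCoeff_rename_swap (i j : Fin n) (f : MvPolynomial (Fin n) ℤ) (x : Fin n → ℤ) :
    intCoeff (rename (Equiv.swap i j) f) x = intCoeff f (x ∘ Equiv.swap i j) := by
  have h : ∀ y : Fin n → ℤ, y ∘ Equiv.swap i j = x ↔ y = x ∘ Equiv.swap i j := fun y =>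
    ⟨fun h => by rw [← h, comp_swap_comp_swap], fun h => by rw [h, comp_swap_comp_swap]⟩
  simp only [intCoeff, coeffSum_rename_swap, h]

lemma cumCoeff_rename_swap (i j : Fin n) (f : MvPolynomial (Fin n) ℤ) (x : Fin n → ℤ) :
    cumCoeff (rename (Equiv.swap i j) f) x = cumCoeff f (x ∘ Equiv.swap i j) := by
  have h : ∀ y : Fin n → ℤ, y ∘ Equiv.swap i j ≤ x ↔ y ≤ x ∘ Equiv.swap i j := fun y =>
    ⟨fun h k => by simpa using h (Equiv.swap i j k),
      fun h k => by simpa using h (Equiv.swap i j k)⟩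
  simp only [cumCoeff, coeffSum_rename_swap, h]

end CoeffSum

/-- The relation `(x_i - x_j) g = f - s f` for coefficient functions `f`, `g`, where `s`
exchanges `x_i` and `x_j`. -/
def IsDividedDiff {n : ℕ} (i j : Fin n) (f g : (Fin n → ℤ) → ℤ) : Prop :=
  ∀ x, g (x - Pi.single i 1) - g (x - Pi.single j 1) = f x - f (x ∘ Equiv.swap i j)

/-- The relation `(x_i - x_j) g = (1 - x_j) f - s ((1 - x_j) f)` for cumulative coefficient
functions `f`, `g`, where `s` exchanges `x_i` and `x_j`. -/
def IsIsobaricDiff {n : ℕ} (i j : Fin n) (f g : (Fin n → ℤ) → ℤ) : Prop :=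
  ∀ x, g (x - Pi.single i 1) - g (x - Pi.single j 1) =
    f x - f (x - Pi.single j 1) -
      (f (x ∘ Equiv.swap i j) - f (x ∘ Equiv.swap i j - Pi.single j 1))

section DividedDiff

variable {n : ℕ} {i j : Fin n}

lemma isDividedDiff_intCoeff {f g : MvPolynomial (Fin n) ℤ}
    (h : (X i - X j) * g = f - rename (Equiv.swap i j) f) :
    IsDividedDiff i j (intCoeff f) (intCoeff g) := by
  intro x
  have := congrArg (fun q => intCoeff q x) h
  simp only [sub_mul] at this
  rw [← intCoeff_X_mul, ← intCoeff_X_mul, ← intCoeff_rename_swap]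
  simpa only [intCoeff, map_sub] using this

lemma isIsobaricDiff_cumCoeff {f g : MvPolynomial (Fin n) ℤ}
    (h : (X i - X j) * g = (1 - X j) * f - rename (Equiv.swap i j) ((1 - X j) * f)) :
    IsIsobaricDiff i j (cumCoeff f) (cumCoeff g) := by
  intro x
  have := congrArg (fun q => cumCoeff q x) h
  simp only [sub_mul, one_mul] at this
  rw [← cumCoeff_X_mul, ← cumCoeff_X_mul, ← cumCoeff_X_mul, ← cumCoeff_X_mul (x := _ ∘ _),
    ← cumCoeff_rename_swap, ← cumCoeff_rename_swap]
  simpa only [cumCoeff, map_sub] using this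

lemma eq_zero_of_shift_eq (hij : i ≠ j) {k : (Fin n → ℤ) → ℤ}
    (hk : ∀ x : Fin n → ℤ, k (x - Pi.single i 1) = k (x - Pi.single j 1))
    (hneg : ∀ x : Fin n → ℤ, x j < 0 → k x = 0) (x : Fin n → ℤ) : k x = 0 := by
  obtain ⟨N, hN⟩ : ∃ N : ℕ, x j < N := ⟨(x j).toNat + 1, by omega⟩
  induction N generalizing x with
  | zero => exact hneg x (by simpa using hN)
  | succ N ih =>
    have h := hk (x + Pi.single i 1)
    rw [add_sub_cancel_right] at h
    rw [h]
    refine ih _ ?_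
    simp [hij.symm]
    push_cast at hN
    omega

lemma IsDividedDiff.unique (hij : i ≠ j) {f g g' : (Fin n → ℤ) → ℤ} (h : IsDividedDiff i j f g)
    (h' : IsDividedDiff i j f g') (hg : ∀ x, x j < 0 → g x = 0)
    (hg' : ∀ x, x j < 0 → g' x = 0) (x : Fin n → ℤ) : g x = g' x := by
  have := eq_zero_of_shift_eq hij (k := fun x => g x - g' x)
    (fun x => by have := h x; have := h' x; linarith)
    (fun x hx => by simp [hg x hx, hg' x hx]) x
  linarith

lemma IsIsobaricDiff.unique (hij : i ≠ j) {f g g' : (Fin n → ℤ) → ℤ} (h : IsIsobaricDiff i j f g)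
    (h' : IsIsobaricDiff i j f g') (hg : ∀ x, x j < 0 → g x = 0)
    (hg' : ∀ x, x j < 0 → g' x = 0) (x : Fin n → ℤ) : g x = g' x := by
  have := eq_zero_of_shift_eq hij (k := fun x => g x - g' x)
    (fun x => by have := h x; have := h' x; linarith)
    (fun x hx => by simp [hg x hx, hg' x hx]) x
  linarith

lemma sub_single_comp_swap (i j : Fin n) (x : Fin n → ℤ) :
    (x - Pi.single i 1) ∘ Equiv.swap i j = x ∘ Equiv.swap i j - Pi.single j 1 := by
  funext k
  by_cases hi : k = i
  · subst hi
    by_cases hij : k = j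
    · subst hij; simp
    · simp [hij, Ne.symm hij]
  by_cases hj : k = j
  · subst hj; simp
  · simp [Equiv.swap_apply_of_ne_of_ne hi hj, hi, hj]

lemma sub_single_comp_swap' (i j : Fin n) (x : Fin n → ℤ) :
    (x - Pi.single j 1) ∘ Equiv.swap i j = x ∘ Equiv.swap i j - Pi.single i 1 := by
  rw [Equiv.swap_comm, sub_single_comp_swap]

lemma IsDividedDiff.symm (hij : i ≠ j) {f g : (Fin n → ℤ) → ℤ} (h : IsDividedDiff i j f g)
    (hg : ∀ x k, x k < 0 → g x = 0) (x : Fin n → ℤ) : g (x ∘ Equiv.swap i j) = g x := by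
  refine IsDividedDiff.unique hij (f := f) (g := fun y => g (y ∘ Equiv.swap i j)) (g' := g)
    (fun x => ?_) h (fun x hx => hg _ i (by simpa using hx)) (fun x hx => hg x j hx) x
  have := h (x ∘ Equiv.swap i j)
  rw [comp_swap_comp_swap] at this
  dsimp only
  rw [sub_single_comp_swap, sub_single_comp_swap']
  linarith

lemma IsDividedDiff.exists_ne_zero (hij : i ≠ j) {f g : (Fin n → ℤ) → ℤ}
    (h : IsDividedDiff i j f g) (hg : ∀ x, x j < 0 → g x = 0) {x : Fin n → ℤ} (hx : g x ≠ 0) :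
    ∃ (k : ℕ) (y : Fin n → ℤ), f y ≠ 0 ∧ (∀ t, t ≠ i → t ≠ j → y t = x t) ∧
      (y i = x i + 1 + k ∧ y j = x j - k ∨ y i = x j - k ∧ y j = x i + 1 + k) := by
  obtain ⟨N, hN⟩ : ∃ N : ℕ, x j < N := ⟨(x j).toNat + 1, by omega⟩
  induction N generalizing x with
  | zero => exact absurd (hg x (by simpa using hN)) hx
  | succ N ih =>
    have h1 := h (x + Pi.single i 1)
    rw [add_sub_cancel_right] at h1
    by_cases h2 : f (x + Pi.single i 1) = 0
    · by_cases h3 : f ((x + Pi.single i 1) ∘ Equiv.swap i j) = 0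
      · have h4 : g (x + Pi.single i 1 - Pi.single j 1) ≠ 0 := by
          rw [h2, h3] at h1
          intro h5
          rw [h5] at h1
          exact hx (by linarith)
        obtain ⟨k, y, hy, hy', hy''⟩ := ih h4 (by simp [hij.symm]; push_cast at hN; omega)
        refine ⟨k + 1, y, hy, fun t ht ht' => ?_, ?_⟩
        · rw [hy' t ht ht']; simp [ht, ht']
        · simp [hij, hij.symm] at hy''
          push_cast
          omega
      · exact ⟨0, _, h3, fun t ht ht' => by simp [Equiv.swap_apply_of_ne_of_ne ht ht', ht],
          Or.inr (by simp [hij.symm])⟩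
    · exact ⟨0, _, h2, fun t ht ht' => by simp [ht], Or.inl (by simp [hij.symm])⟩

end DividedDiff

/-- The vectors whose partial sums are bounded below by the set function `ρ`. -/
def IsAbove {n : ℕ} (ρ : Finset (Fin n) → ℤ) (x : Fin n → ℤ) : Prop :=
  ∀ T : Finset (Fin n), ρ T ≤ ∑ i ∈ T, x i

/-- The vectors of `IsAbove ρ` on which the total sum is minimal. -/
def IsBase {n : ℕ} (ρ : Finset (Fin n) → ℤ) (x : Fin n → ℤ) : Prop :=
  IsAbove ρ x ∧ ∑ i, x i = ρ Finset.univ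

/-- Nonnegative supermodular set functions all of whose values are attained on a base. -/
structure IsContrapolymatroid {n : ℕ} (ρ : Finset (Fin n) → ℤ) : Prop where
  singleton_nonneg : ∀ i, 0 ≤ ρ {i}
  supermodular : ∀ A B, ρ A + ρ B ≤ ρ (A ∪ B) + ρ (A ∩ B)
  attained : ∀ T, ∃ x, IsBase ρ x ∧ ∑ i ∈ T, x i = ρ T

/-- The set function obtained from `ρ` by a divided difference in directions `p`, `q`. -/
def dropSwap {n : ℕ} (p q : Fin n) (ρ : Finset (Fin n) → ℤ) (T : Finset (Fin n)) : ℤ :=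
  if p ∈ T then if q ∈ T then ρ T - 1 else ρ (insert q (T.erase p)) else ρ T

section Contrapolymatroid

variable {n : ℕ} {ρ : Finset (Fin n) → ℤ} {p q : Fin n}

lemma IsAbove.nonneg (hρ : IsContrapolymatroid ρ) {x : Fin n → ℤ} (hx : IsAbove ρ x) (i : Fin n) :
    0 ≤ x i := by
  have := hx {i}
  have := hρ.singleton_nonneg i
  simp at *
  omega

lemma IsAbove.sum_union_eq (hρ : IsContrapolymatroid ρ) {x : Fin n → ℤ} (hx : IsAbove ρ x)
    {A B : Finset (Fin n)} (hA : ∑ i ∈ A, x i = ρ A) (hB : ∑ i ∈ B, x i = ρ B) :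
    ∑ i ∈ A ∪ B, x i = ρ (A ∪ B) := by
  have h1 := Finset.sum_union_inter (s₁ := A) (s₂ := B) (f := x)
  have h2 := hρ.supermodular A B
  have h3 := hx (A ∪ B)
  have h4 := hx (A ∩ B)
  omega

lemma forall_finset_iff_insert (hpq : p ≠ q) (P : Finset (Fin n) → Prop) :
    (∀ T, P T) ↔ ∀ A, p ∉ A → q ∉ A →
      P A ∧ P (insert p A) ∧ P (insert q A) ∧ P (insert p (insert q A)) := by
  refine ⟨fun h A _ _ => ⟨h _, h _, h _, h _⟩, fun h T => ?_⟩
  obtain ⟨h0, h1, h2, h3⟩ := h ((T.erase p).erase q) (by simp) (by simp)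
  by_cases hp : p ∈ T <;> by_cases hq : q ∈ T
  · rwa [Finset.insert_erase (by simp [hq, hpq.symm]), Finset.insert_erase hp] at h3
  · rwa [Finset.erase_eq_of_notMem (by simp [hq]), Finset.insert_erase hp] at h1
  · rwa [Finset.insert_erase (by simp [hq, hpq.symm]), Finset.erase_eq_of_notMem hp] at h2
  · rwa [Finset.erase_eq_of_notMem (by simp [hq]), Finset.erase_eq_of_notMem hp] at h0

lemma exists_eq_insert (p q : Fin n) (hpq : p ≠ q) (T : Finset (Fin n)) :
    ∃ A, p ∉ A ∧ q ∉ A ∧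
      (T = A ∨ T = insert p A ∨ T = insert q A ∨ T = insert p (insert q A)) :=
  (forall_finset_iff_insert hpq fun T => ∃ A, p ∉ A ∧ q ∉ A ∧
    (T = A ∨ T = insert p A ∨ T = insert q A ∨ T = insert p (insert q A))).mpr
    (fun A hp hq => by refine ⟨?_, ?_, ?_, ?_⟩ <;> exact ⟨A, hp, hq, by simp⟩) T

lemma dropSwap_of_notMem {A : Finset (Fin n)} (hp : p ∉ A) : dropSwap p q ρ A = ρ A := by
  simp [dropSwap, hp]

lemma dropSwap_insert_left (hpq : p ≠ q) {A : Finset (Fin n)} (hp : p ∉ A) (hq : q ∉ A) :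
    dropSwap p q ρ (insert p A) = ρ (insert q A) := by
  simp [dropSwap, hp, hq, hpq.symm]

lemma dropSwap_insert_right (hpq : p ≠ q) {A : Finset (Fin n)} (hp : p ∉ A) :
    dropSwap p q ρ (insert q A) = ρ (insert q A) := by
  simp [dropSwap, hp, hpq]

lemma dropSwap_insert_insert (A : Finset (Fin n)) :
    dropSwap p q ρ (insert p (insert q A)) = ρ (insert p (insert q A)) - 1 := by
  simp [dropSwap]

lemma dropSwap_supermodular (hpq : p ≠ q) (hρ : IsContrapolymatroid ρ)
    (hlt : ∀ A, p ∉ A → q ∉ A → ρ (insert q A) < ρ (insert p A)) (A B : Finset (Fin n)) :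
    dropSwap p q ρ A + dropSwap p q ρ B ≤ dropSwap p q ρ (A ∪ B) + dropSwap p q ρ (A ∩ B) := by
  obtain ⟨A, hpA, hqA, hA⟩ := exists_eq_insert p q hpq A
  obtain ⟨B, hpB, hqB, hB⟩ := exists_eq_insert p q hpq B
  have hqp : ∀ T : Finset (Fin n), insert q (insert p T) = insert p (insert q T) :=
    fun T => Finset.insert_comm q p T
  have s00 := hρ.supermodular A B
  have sq0 := hρ.supermodular (insert q A) B
  have s0q := hρ.supermodular A (insert q B)
  have sqq := hρ.supermodular (insert q A) (insert q B)
  have spq := hρ.supermodular (insert p A) (insert q B)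
  have sqp := hρ.supermodular (insert q A) (insert p B)
  have sr0 := hρ.supermodular (insert p (insert q A)) B
  have s0r := hρ.supermodular A (insert p (insert q B))
  have srq := hρ.supermodular (insert p (insert q A)) (insert q B)
  have sqr := hρ.supermodular (insert q A) (insert p (insert q B))
  have srr := hρ.supermodular (insert p (insert q A)) (insert p (insert q B))
  have l1 := hlt A hpA hqA
  have l2 := hlt B hpB hqB
  rcases hA with rfl | rfl | rfl | rfl <;> rcases hB with rfl | rfl | rfl | rfl <;>
  · simp only [Finset.insert_union, Finset.union_insert, Finset.insert_idem, hqp,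
      Finset.insert_inter_of_notMem, Finset.inter_insert_of_notMem,
      Finset.inter_insert_of_mem, Finset.mem_insert, Finset.mem_union, Finset.mem_inter, hpA, hqA,
      hpB, hqB, hpq, hpq.symm, not_false_eq_true, or_false, or_true, and_false,
      dropSwap_insert_insert, dropSwap_insert_left, dropSwap_of_notMem, ne_eq] at *
    omega

lemma isAbove_iff (hpq : p ≠ q) (ρ : Finset (Fin n) → ℤ) (y : Fin n → ℤ) :
    IsAbove ρ y ↔ ∀ A, p ∉ A → q ∉ A → ρ A ≤ ∑ i ∈ A, y i ∧
      ρ (insert p A) ≤ y p + ∑ i ∈ A, y i ∧ ρ (insert q A) ≤ y q + ∑ i ∈ A, y i ∧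
      ρ (insert p (insert q A)) ≤ y p + y q + ∑ i ∈ A, y i := by
  rw [IsAbove, forall_finset_iff_insert hpq]
  refine forall₃_congr fun A hp hq => ?_
  rw [Finset.sum_insert hp, Finset.sum_insert hq, Finset.sum_insert (by simp [hp, hpq]),
    Finset.sum_insert hq, add_assoc]

lemma isAbove_dropSwap_iff (hpq : p ≠ q) (ρ : Finset (Fin n) → ℤ) (y : Fin n → ℤ) :
    IsAbove (dropSwap p q ρ) y ↔ ∀ A, p ∉ A → q ∉ A → ρ A ≤ ∑ i ∈ A, y i ∧
      ρ (insert q A) ≤ y p + ∑ i ∈ A, y i ∧ ρ (insert q A) ≤ y q + ∑ i ∈ A, y i ∧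
      ρ (insert p (insert q A)) - 1 ≤ y p + y q + ∑ i ∈ A, y i := by
  rw [isAbove_iff hpq]
  refine forall₃_congr fun A hp hq => ?_
  rw [dropSwap_of_notMem hp, dropSwap_insert_left hpq hp hq, dropSwap_insert_right hpq hp,
    dropSwap_insert_insert]

lemma sum_congr_of_notMem {x y : Fin n → ℤ} (h : ∀ t, t ≠ p → t ≠ q → y t = x t)
    {A : Finset (Fin n)} (hp : p ∉ A) (hq : q ∉ A) : ∑ i ∈ A, y i = ∑ i ∈ A, x i :=
  Finset.sum_congr rfl fun t ht => h t (by rintro rfl; exact hp ht) (by rintro rfl; exact hq ht)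

lemma sum_comp_swap_of_notMem (x : Fin n → ℤ) {A : Finset (Fin n)} (hp : p ∉ A) (hq : q ∉ A) :
    ∑ i ∈ A, (x ∘ Equiv.swap p q) i = ∑ i ∈ A, x i :=
  sum_congr_of_notMem (fun t ht ht' => by simp [Equiv.swap_apply_of_ne_of_ne ht ht']) hp hq

lemma sum_sub_single (x : Fin n → ℤ) (r : Fin n) (A : Finset (Fin n)) :
    ∑ i ∈ A, (x - Pi.single r 1 : Fin n → ℤ) i = ∑ i ∈ A, x i - if r ∈ A then 1 else 0 := by
  simp [Finset.sum_sub_distrib, Pi.single_apply]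

lemma sum_univ_eq (hpq : p ≠ q) (x : Fin n → ℤ) :
    ∑ i, x i = x p + x q + ∑ i ∈ (Finset.univ.erase p).erase q, x i := by
  rw [add_assoc, Finset.add_sum_erase _ _ (by simp [hpq.symm]), Finset.add_sum_erase _ _ (by simp)]

lemma IsAbove.dropSwap_sub_single (hpq : p ≠ q)
    (hlt : ∀ A, p ∉ A → q ∉ A → ρ (insert q A) < ρ (insert p A)) {x : Fin n → ℤ}
    (hx : IsAbove ρ x) : IsAbove (dropSwap p q ρ) (x - Pi.single p 1) := by
  rw [isAbove_dropSwap_iff hpq]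
  rw [isAbove_iff hpq] at hx
  intro A hp hq
  have := hx A hp hq
  have := hlt A hp hq
  rw [sum_sub_single, if_neg hp]
  simp [hpq.symm]
  omega

lemma IsAbove.dropSwap_comp_swap (hpq : p ≠ q) {x : Fin n → ℤ}
    (hx : IsAbove (dropSwap p q ρ) x) : IsAbove (dropSwap p q ρ) (x ∘ Equiv.swap p q) := by
  rw [isAbove_dropSwap_iff hpq] at hx ⊢
  intro A hp hq
  have := hx A hp hq
  rw [sum_comp_swap_of_notMem x hp hq]
  simp
  omega

lemma dropSwap_univ : dropSwap p q ρ Finset.univ = ρ Finset.univ - 1 := by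
  simp [dropSwap]

lemma IsBase.dropSwap_sub_single (hpq : p ≠ q)
    (hlt : ∀ A, p ∉ A → q ∉ A → ρ (insert q A) < ρ (insert p A)) {x : Fin n → ℤ}
    (hx : IsBase ρ x) : IsBase (dropSwap p q ρ) (x - Pi.single p 1) :=
  ⟨hx.1.dropSwap_sub_single hpq hlt, by
    rw [sum_sub_single, hx.2, dropSwap_univ, if_pos (Finset.mem_univ p)]⟩

lemma IsBase.dropSwap_comp_swap (hpq : p ≠ q) {x : Fin n → ℤ}
    (hx : IsBase (dropSwap p q ρ) x) : IsBase (dropSwap p q ρ) (x ∘ Equiv.swap p q) :=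
  ⟨hx.1.dropSwap_comp_swap hpq, by rw [← hx.2]; exact Equiv.sum_comp (Equiv.swap p q) x⟩

lemma IsContrapolymatroid.dropSwap (hpq : p ≠ q) (hρ : IsContrapolymatroid ρ)
    (hlt : ∀ A, p ∉ A → q ∉ A → ρ (insert q A) < ρ (insert p A)) :
    IsContrapolymatroid (dropSwap p q ρ) where
  singleton_nonneg i := by
    have h1 := hρ.singleton_nonneg i
    have h2 := hρ.singleton_nonneg q
    by_cases hi : p = i
    · subst hi
      simpa [_root_.dropSwap, hpq.symm] using h2
    · simpa [_root_.dropSwap, hi] using h1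
  supermodular := dropSwap_supermodular hpq hρ hlt
  attained := by
    rw [forall_finset_iff_insert hpq]
    intro A hp hq
    refine ⟨?_, ?_, ?_, ?_⟩
    · obtain ⟨x, hx, hxA⟩ := hρ.attained A
      refine ⟨_, hx.dropSwap_sub_single hpq hlt, ?_⟩
      rw [sum_sub_single, if_neg hp, hxA, dropSwap_of_notMem hp, sub_zero]
    · obtain ⟨x, hx, hxA⟩ := hρ.attained (insert q A)
      refine ⟨_, (hx.dropSwap_sub_single hpq hlt).dropSwap_comp_swap hpq, ?_⟩
      rw [Finset.sum_insert hp, sum_comp_swap_of_notMem _ hp hq, sum_sub_single, if_neg hp,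
        dropSwap_insert_left hpq hp hq, ← hxA, Finset.sum_insert hq]
      simp [hpq.symm]
    · obtain ⟨x, hx, hxA⟩ := hρ.attained (insert q A)
      refine ⟨_, hx.dropSwap_sub_single hpq hlt, ?_⟩
      rw [sum_sub_single, if_neg (by simp [hp, hpq]), hxA, dropSwap_insert_right hpq hp, sub_zero]
    · obtain ⟨x, hx, hxA⟩ := hρ.attained (insert p (insert q A))
      refine ⟨_, hx.dropSwap_sub_single hpq hlt, ?_⟩
      rw [sum_sub_single, if_pos (by simp), hxA, dropSwap_insert_insert]

lemma exists_isGreatest_family (p q : Fin n) (h : Finset (Fin n) → ℤ) :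
    ∃ A, p ∉ A ∧ q ∉ A ∧ ∀ B, p ∉ B → q ∉ B → h B ≤ h A := by
  obtain ⟨A, hA, hmax⟩ := Finset.exists_max_image
    (Finset.univ.filter fun A : Finset (Fin n) => p ∉ A ∧ q ∉ A) h ⟨∅, by simp⟩
  simp only [Finset.mem_filter, Finset.mem_univ, true_and] at hA hmax
  exact ⟨A, hA.1, hA.2, fun B h1 h2 => hmax B ⟨h1, h2⟩⟩

/-- The intersection of `IsAbove ρ` with a plane parallel to the `p`, `q` coordinates is described
by three inequalities. -/
lemma exists_slice (hpq : p ≠ q) (hρ : IsContrapolymatroid ρ)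
    (hlt : ∀ A, p ∉ A → q ∉ A → ρ (insert q A) < ρ (insert p A)) (x : Fin n → ℤ) :
    ∃ (C : Prop) (α β σ : ℤ) (Aα Aσ : Finset (Fin n)),
      (∀ y, (∀ t, t ≠ p → t ≠ q → y t = x t) →
        ((IsAbove ρ y ↔ C ∧ α ≤ y p ∧ β ≤ y q ∧ σ ≤ y p + y q) ∧
          (IsAbove (dropSwap p q ρ) y ↔ C ∧ β ≤ y p ∧ β ≤ y q ∧ σ - 1 ≤ y p + y q))) ∧
      (C → α + β ≤ σ) ∧ 0 ≤ β ∧ β < α ∧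
      ρ Finset.univ - ∑ i ∈ (Finset.univ.erase p).erase q, x i ≤ σ ∧
      p ∉ Aα ∧ q ∉ Aα ∧ α = ρ (insert p Aα) - ∑ i ∈ Aα, x i ∧
      p ∉ Aσ ∧ q ∉ Aσ ∧ σ = ρ (insert p (insert q Aσ)) - ∑ i ∈ Aσ, x i := by
  obtain ⟨Aα, hpα, hqα, hα⟩ :=
    exists_isGreatest_family p q fun A => ρ (insert p A) - ∑ i ∈ A, x i
  obtain ⟨Aβ, hpβ, hqβ, hβ⟩ :=
    exists_isGreatest_family p q fun A => ρ (insert q A) - ∑ i ∈ A, x i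
  obtain ⟨Aσ, hpσ, hqσ, hσ⟩ :=
    exists_isGreatest_family p q fun A => ρ (insert p (insert q A)) - ∑ i ∈ A, x i
  refine ⟨∀ A, p ∉ A → q ∉ A → ρ A ≤ ∑ i ∈ A, x i, _, ρ (insert q Aβ) - ∑ i ∈ Aβ, x i, _, Aα, Aσ,
    fun y hy => ⟨?_, ?_⟩, fun hC => ?_, ?_, ?_, ?_, hpα, hqα, rfl, hpσ, hqσ, rfl⟩
  · rw [isAbove_iff hpq]
    constructor
    · intro h
      refine ⟨fun A hp hq => ?_, ?_, ?_, ?_⟩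
      · have := (h A hp hq).1
        rwa [sum_congr_of_notMem hy hp hq] at this
      · have := (h Aα hpα hqα).2.1
        rw [sum_congr_of_notMem hy hpα hqα] at this
        omega
      · have := (h Aβ hpβ hqβ).2.2.1
        rw [sum_congr_of_notMem hy hpβ hqβ] at this
        omega
      · have := (h Aσ hpσ hqσ).2.2.2
        rw [sum_congr_of_notMem hy hpσ hqσ] at this
        omega
    · rintro ⟨hC, h1, h2, h3⟩ A hp hq
      have := hC A hp hq
      have := hα A hp hq
      have := hβ A hp hq
      have := hσ A hp hq
      rw [sum_congr_of_notMem hy hp hq]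
      omega
  · rw [isAbove_dropSwap_iff hpq]
    constructor
    · intro h
      refine ⟨fun A hp hq => ?_, ?_, ?_, ?_⟩
      · have := (h A hp hq).1
        rwa [sum_congr_of_notMem hy hp hq] at this
      · have := (h Aβ hpβ hqβ).2.1
        rw [sum_congr_of_notMem hy hpβ hqβ] at this
        omega
      · have := (h Aβ hpβ hqβ).2.2.1
        rw [sum_congr_of_notMem hy hpβ hqβ] at this
        omega
      · have := (h Aσ hpσ hqσ).2.2.2
        rw [sum_congr_of_notMem hy hpσ hqσ] at this
        omega
    · rintro ⟨hC, h1, h2, h3⟩ A hp hq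
      have := hC A hp hq
      have := hβ A hp hq
      have := hσ A hp hq
      rw [sum_congr_of_notMem hy hp hq]
      omega
  · have h1 := hρ.supermodular (insert p Aα) (insert q Aβ)
    have h2 := Finset.sum_union_inter (s₁ := Aα) (s₂ := Aβ) (f := x)
    have h3 := hC (Aα ∩ Aβ) (by simp [hpα]) (by simp [hqα])
    have h4 := hσ (Aα ∪ Aβ) (by simp [hpα, hpβ]) (by simp [hqα, hqβ])
    rw [Finset.insert_union, Finset.union_insert, Finset.insert_inter_of_notMem (by simp [hpβ, hpq]),
      Finset.inter_insert_of_notMem (by simp [hqα])] at h1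
    omega
  · have h1 := hβ ∅ (by simp) (by simp)
    have h2 := hρ.singleton_nonneg q
    simp at h1
    omega
  · have h1 := hα Aβ hpβ hqβ
    have h2 := hlt Aβ hpβ hqβ
    omega
  · have h1 := hσ ((Finset.univ.erase p).erase q) (by simp) (by simp)
    rwa [Finset.insert_erase (by simp [hpq.symm]), Finset.insert_erase (by simp)] at h1

lemma IsAbove.exists_tight {x : Fin n → ℤ} (hx : IsAbove ρ x) {r : Fin n}
    (hr : ¬ IsAbove ρ (x - Pi.single r 1)) : ∃ T, r ∈ T ∧ ∑ i ∈ T, x i = ρ T := by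
  simp only [IsAbove, not_forall, not_le] at hr
  obtain ⟨T, hT⟩ := hr
  have := hx T
  rw [sum_sub_single] at hT
  split_ifs at hT with h
  · exact ⟨T, h, by omega⟩
  · omega

lemma sum_move (x : Fin n → ℤ) {T : Finset (Fin n)} (hp : p ∈ T) (hq : q ∈ T) :
    ∑ i ∈ T, (x - Pi.single p 1 + Pi.single q 1 : Fin n → ℤ) i = ∑ i ∈ T, x i := by
  simp [Finset.sum_add_distrib, Finset.sum_sub_distrib, Pi.single_apply, hp, hq]

/-- If moving a unit from `p` to `q` keeps `x` above `ρ`, and some set containing `p` and `q` is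
tight, then the other coordinates can be lowered until both vectors become bases. -/
lemma IsAbove.exists_isBase_le (hρ : IsContrapolymatroid ρ) {x : Fin n → ℤ} (hx : IsAbove ρ x)
    (hx' : IsAbove ρ (x - Pi.single p 1 + Pi.single q 1)) {T : Finset (Fin n)} (hp : p ∈ T)
    (hq : q ∈ T) (hT : ∑ i ∈ T, x i = ρ T) :
    ∃ y ≤ x, y p = x p ∧ y q = x q ∧ IsBase ρ y ∧
      IsBase ρ (y - Pi.single p 1 + Pi.single q 1) := by
  obtain ⟨N, hN⟩ : ∃ N : ℕ, ∑ i, x i < N := ⟨(∑ i, x i).toNat + 1, by omega⟩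
  induction N generalizing x with
  | zero =>
    have := Finset.sum_nonneg fun i (_ : i ∈ Finset.univ) => hx.nonneg hρ i
    simp only [Nat.cast_zero] at hN
    omega
  | succ N ih =>
    by_cases h : ∃ r, r ≠ p ∧ r ≠ q ∧ IsAbove ρ (x - Pi.single r 1) ∧
        IsAbove ρ (x - Pi.single p 1 + Pi.single q 1 - Pi.single r 1)
    · obtain ⟨r, hrp, hrq, h1, h2⟩ := h
      have h3 := h1 T
      have hs := sum_sub_single x r Finset.univ
      rw [if_pos (Finset.mem_univ r)] at hs
      have hrT : r ∉ T := fun hrT => by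
        rw [sum_sub_single, if_pos hrT] at h3
        omega
      obtain ⟨y, hy, hyp, hyq, hyb⟩ := ih h1 (by convert h2 using 1; abel)
        (by rw [sum_sub_single, if_neg hrT, hT, sub_zero]) (by push_cast at hN; omega)
      refine ⟨y, hy.trans (sub_le_self _ ?_), ?_, ?_, hyb⟩
      · exact Pi.single_nonneg.mpr zero_le_one
      · rw [hyp]; simp [hrp.symm]
      · rw [hyq]; simp [hrq.symm]
    · have hcov : ∀ r, ∃ T', r ∈ T' ∧ T ⊆ T' ∧ ∑ i ∈ T', x i = ρ T' := by
        intro r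
        by_cases hrp : r = p
        · exact ⟨T, hrp ▸ hp, subset_rfl, hT⟩
        by_cases hrq : r = q
        · exact ⟨T, hrq ▸ hq, subset_rfl, hT⟩
        by_cases h1 : IsAbove ρ (x - Pi.single r 1)
        · have h2 := fun h2 => h ⟨r, hrp, hrq, h1, h2⟩
          obtain ⟨T', hr, hT'⟩ := hx'.exists_tight h2
          refine ⟨T' ∪ T, by simp [hr], Finset.subset_union_right, ?_⟩
          have := hx'.sum_union_eq hρ hT' (by rw [sum_move x hp hq, hT])
          rwa [sum_move x (by simp [hp]) (by simp [hq])] at this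
        · obtain ⟨T', hr, hT'⟩ := hx.exists_tight h1
          exact ⟨T' ∪ T, by simp [hr], Finset.subset_union_right, hx.sum_union_eq hρ hT' hT⟩
      have huniv : ∀ R : Finset (Fin n), ∃ T', R ⊆ T' ∧ ∑ i ∈ T', x i = ρ T' := by
        intro R
        induction R using Finset.induction_on with
        | empty => exact ⟨T, by simp, hT⟩
        | insert r R _ ihR =>
          obtain ⟨T1, h1, h1'⟩ := ihR
          obtain ⟨T2, h2, -, h2'⟩ := hcov r
          refine ⟨T1 ∪ T2, ?_, hx.sum_union_eq hρ h1' h2'⟩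
          exact Finset.insert_subset (by simp [h2]) (h1.trans Finset.subset_union_left)
      obtain ⟨T', h1, h2⟩ := huniv Finset.univ
      obtain rfl : T' = Finset.univ := Finset.univ_subset_iff.mp h1
      exact ⟨x, le_rfl, rfl, rfl, ⟨hx, h2⟩, hx', by
        rw [sum_move x (Finset.mem_univ p) (Finset.mem_univ q), h2]⟩

/-- The indicator function of a predicate. -/
def indicatorFun {ι : Type*} (P : ι → Prop) (x : ι) : ℤ := if P x then 1 else 0

lemma rank_insert_lt (hpq : p ≠ q) (hρ : IsContrapolymatroid ρ) {g : (Fin n → ℤ) → ℤ}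
    (hfg : IsDividedDiff p q (indicatorFun (IsBase ρ)) g) (hneg : ∀ x k, x k < 0 → g x = 0)
    (hle : ∀ x, indicatorFun (IsBase ρ) x ≤ g (x - Pi.single p 1)) (A : Finset (Fin n))
    (hp : p ∉ A) (hq : q ∉ A) : ρ (insert q A) < ρ (insert p A) := by
  obtain ⟨x, hx, hxA⟩ := hρ.attained (insert p A)
  rw [Finset.sum_insert hp] at hxA
  have hxq := hx.1 (insert q A)
  rw [Finset.sum_insert hq] at hxq
  by_cases hlt : x q < x p
  · omega
  have hg : g ((x - Pi.single p 1) ∘ Equiv.swap p q) ≠ 0 := by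
    have := hle x
    rw [hfg.symm hpq hneg]
    rw [indicatorFun, if_pos hx] at this
    omega
  obtain ⟨k, y, hy, hyx, hpqy⟩ := hfg.exists_ne_zero hpq (fun x hx => hneg x q hx) hg
  have hyb : IsBase ρ y := by
    by_contra h
    exact hy (if_neg h)
  have hyA : ∑ i ∈ A, y i = ∑ i ∈ A, x i :=
    sum_congr_of_notMem (fun t ht ht' => by
      rw [hyx t ht ht']; simp [Equiv.swap_apply_of_ne_of_ne ht ht', ht]) hp hq
  have h1 := hyb.1 (insert p A)
  have h2 := hyb.1 (insert q A)
  rw [Finset.sum_insert hp] at h1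
  rw [Finset.sum_insert hq] at h2
  simp [hpq.symm] at hpqy
  omega

lemma slice_dichotomy (hpq : p ≠ q) (hρ : IsContrapolymatroid ρ) {g : (Fin n → ℤ) → ℤ}
    (hfg : IsDividedDiff p q (indicatorFun (IsBase ρ)) g) (hg0 : ∀ x, 0 ≤ g x) (hg1 : ∀ x, g x ≤ 1)
    {x : Fin n → ℤ} {α β σ : ℤ} {C : Prop} {Aα Aσ : Finset (Fin n)}
    (hslice : ∀ y, (∀ t, t ≠ p → t ≠ q → y t = x t) →
      (IsAbove ρ y ↔ C ∧ α ≤ y p ∧ β ≤ y q ∧ σ ≤ y p + y q))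
    (hσ : α + β ≤ σ) (hC : C) (hpα : p ∉ Aα) (hqα : q ∉ Aα)
    (hα : α = ρ (insert p Aα) - ∑ i ∈ Aα, x i) (hpσ : p ∉ Aσ) (hqσ : q ∉ Aσ)
    (hσ' : σ = ρ (insert p (insert q Aσ)) - ∑ i ∈ Aσ, x i) (hβα : β < α) :
    σ = α + β ∨ α = β + 1 := by
  by_contra! hne
  let z : Fin n → ℤ := Function.update (Function.update x p (σ - β)) q β
  have hzp : z p = σ - β := by simp [z, hpq]
  have hzq : z q = β := by simp [z]
  have hzt : ∀ t, t ≠ p → t ≠ q → z t = x t := fun t h1 h2 => by simp [z, h1, h2]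
  have hz : IsAbove ρ z := (hslice z hzt).mpr ⟨hC, by omega, by omega, by omega⟩
  have hz' : IsAbove ρ (z - Pi.single p 1 + Pi.single q 1) := by
    refine (hslice _ fun t h1 h2 => ?_).mpr ⟨hC, ?_, ?_, ?_⟩
    · simp [h1, h2, hzt]
    all_goals simp [hpq, hpq.symm, hzp, hzq]
    all_goals omega
  obtain ⟨y, hyz, hyp, hyq, hy, hy'⟩ := hz.exists_isBase_le hρ hz' (T := insert p (insert q Aσ))
    (by simp) (by simp) (by
      rw [Finset.sum_insert (by simp [hpq, hpσ]), Finset.sum_insert hqσ, hzp, hzq,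
        sum_congr_of_notMem hzt hpσ hqσ]
      omega)
  have hlow : ∀ u : Fin n → ℤ, (∀ t, t ≠ p → t ≠ q → u t = y t) → u p < α →
      indicatorFun (IsBase ρ) u = 0 := by
    intro u hu hup
    refine if_neg fun h => ?_
    have h1 := h.1 (insert p Aα)
    rw [Finset.sum_insert hpα, sum_congr_of_notMem hu hpα hqα] at h1
    have h2 := Finset.sum_le_sum fun i (_ : i ∈ Aα) => hyz i
    rw [sum_congr_of_notMem hzt hpα hqα] at h2
    omega
  have e1 := hfg y
  have e2 := hfg (y - Pi.single p 1 + Pi.single q 1)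
  have v1 := hlow (y ∘ Equiv.swap p q) (fun t h1 h2 => by
    simp [Equiv.swap_apply_of_ne_of_ne h1 h2]) (by simp [hyq, hzq]; omega)
  have v2 := hlow ((y - Pi.single p 1 + Pi.single q 1 : Fin n → ℤ) ∘ Equiv.swap p q)
    (fun t h1 h2 => by simp [Equiv.swap_apply_of_ne_of_ne h1 h2, h1, h2])
    (by simp [hpq.symm, hyq, hzq]; omega)
  rw [v1, indicatorFun, if_pos hy] at e1
  rw [add_sub_cancel_right, v2, indicatorFun, if_pos hy'] at e2
  have := hg0 (y - Pi.single q 1)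
  have := hg1 (y - Pi.single p 1 + Pi.single q 1 - Pi.single p 1)
  omega

lemma indicatorFun_eq_of_iff {ι : Type*} {P : ι → Prop} {x : ι} {Q : Prop} [Decidable Q]
    (h : P x ↔ Q) : indicatorFun P x = if Q then 1 else 0 := by
  simp only [indicatorFun, h]

/-- The descriptions of a coefficient function by the bases of a contrapolymatroid, and of a
cumulative coefficient function by the vectors above it, are preserved by divided differences. -/
lemma IsContrapolymatroid.dividedDiff (hpq : p ≠ q) (hρ : IsContrapolymatroid ρ)
    {g K : (Fin n → ℤ) → ℤ} (hfg : IsDividedDiff p q (indicatorFun (IsBase ρ)) g)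
    (hFK : IsIsobaricDiff p q (indicatorFun (IsAbove ρ)) K) (hneg : ∀ x k, x k < 0 → g x = 0)
    (hKneg : ∀ x k, x k < 0 → K x = 0) (hg0 : ∀ x, 0 ≤ g x) (hg1 : ∀ x, g x ≤ 1)
    (hle : ∀ x, indicatorFun (IsBase ρ) x ≤ g (x - Pi.single p 1)) :
    ∃ ρ', IsContrapolymatroid ρ' ∧ g = indicatorFun (IsBase ρ') ∧
      K = indicatorFun (IsAbove ρ') := by
  have hlt := rank_insert_lt hpq hρ hfg hneg hle
  have hρ' := hρ.dropSwap hpq hlt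
  refine ⟨_, hρ', funext fun x => ?_, funext fun x => ?_⟩
  · refine hfg.unique hpq (g' := indicatorFun (IsBase (_root_.dropSwap p q ρ)))
      (fun x => ?_) (fun x hx => hneg x q hx) (fun x hx => if_neg fun h => ?_) x
    · obtain ⟨C, α, β, σ, Aα, Aσ, hsl, hσ, hβ, hβα, hτ, hpα, hqα, hα, hpσ, hqσ, hσ'⟩ :=
        exists_slice hpq hρ hlt x
      have hdi : C → σ = α + β ∨ α = β + 1 := fun hC => slice_dichotomy hpq hρ hfg hg0 hg1
        (fun y hy => (hsl y hy).1) (hσ hC) hC hpα hqα hα hpσ hqσ hσ' hβα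
      have hpu : p ∉ (Finset.univ.erase p).erase q := by simp
      have hqu : q ∉ (Finset.univ.erase p).erase q := by simp
      have h1 : ∀ y, (∀ t, t ≠ p → t ≠ q → y t = x t) → (IsBase ρ y ↔ (C ∧ α ≤ y p ∧ β ≤ y q ∧
          σ ≤ y p + y q) ∧ y p + y q =
            ρ Finset.univ - ∑ i ∈ (Finset.univ.erase p).erase q, x i) := fun y hy => by
        rw [IsBase, (hsl y hy).1, sum_univ_eq hpq, sum_congr_of_notMem hy hpu hqu, eq_sub_iff_add_eq]
      have h2 : ∀ y, (∀ t, t ≠ p → t ≠ q → y t = x t) → (IsBase (_root_.dropSwap p q ρ) y ↔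
          (C ∧ β ≤ y p ∧ β ≤ y q ∧ σ - 1 ≤ y p + y q) ∧ y p + y q =
            ρ Finset.univ - 1 - ∑ i ∈ (Finset.univ.erase p).erase q, x i) := fun y hy => by
        rw [IsBase, (hsl y hy).2, sum_univ_eq hpq, sum_congr_of_notMem hy hpu hqu, dropSwap_univ,
          eq_sub_iff_add_eq (a := y p + y q)]
      rw [indicatorFun_eq_of_iff (h1 x fun _ _ _ => rfl),
        indicatorFun_eq_of_iff (h1 (x ∘ Equiv.swap p q) fun t h1 h2 => by
          simp [Equiv.swap_apply_of_ne_of_ne h1 h2]),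
        indicatorFun_eq_of_iff (h2 (x - Pi.single p 1) fun t h1 h2 => by simp [h1]),
        indicatorFun_eq_of_iff (h2 (x - Pi.single q 1) fun t h1 h2 => by simp [h2])]
      simp only [Pi.sub_apply, Pi.single_eq_same, Pi.single_eq_of_ne hpq,
        Pi.single_eq_of_ne hpq.symm, Function.comp_apply, Equiv.swap_apply_left,
        Equiv.swap_apply_right, sub_zero]
      by_cases hC : C
      · have := hdi hC
        have := hσ hC
        simp only [hC, true_and]
        split_ifs <;> omega
      · simp [hC]
    · have := h.1.nonneg hρ' q
      omega
  · refine hFK.unique hpq (g' := indicatorFun (IsAbove (_root_.dropSwap p q ρ)))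
      (fun x => ?_) (fun x hx => hKneg x q hx) (fun x hx => if_neg fun h => ?_) x
    · obtain ⟨C, α, β, σ, Aα, Aσ, hsl, hσ, hβ, hβα, hτ, hpα, hqα, hα, hpσ, hqσ, hσ'⟩ :=
        exists_slice hpq hρ hlt x
      have hdi : C → σ = α + β ∨ α = β + 1 := fun hC => slice_dichotomy hpq hρ hfg hg0 hg1
        (fun y hy => (hsl y hy).1) (hσ hC) hC hpα hqα hα hpσ hqσ hσ' hβα
      rw [indicatorFun_eq_of_iff (hsl x fun _ _ _ => rfl).1,
        indicatorFun_eq_of_iff (hsl (x ∘ Equiv.swap p q) fun t h1 h2 => by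
          simp [Equiv.swap_apply_of_ne_of_ne h1 h2]).1,
        indicatorFun_eq_of_iff (hsl (x - Pi.single q 1) fun t h1 h2 => by simp [h2]).1,
        indicatorFun_eq_of_iff (hsl (x ∘ Equiv.swap p q - Pi.single q 1) fun t h1 h2 => by
          simp [Equiv.swap_apply_of_ne_of_ne h1 h2, h2]).1,
        indicatorFun_eq_of_iff (hsl (x - Pi.single p 1) fun t h1 h2 => by simp [h1]).2,
        indicatorFun_eq_of_iff (hsl (x - Pi.single q 1) fun t h1 h2 => by simp [h2]).2]
      simp only [Pi.sub_apply, Pi.single_eq_same, Pi.single_eq_of_ne hpq,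
        Pi.single_eq_of_ne hpq.symm, Function.comp_apply, Equiv.swap_apply_left,
        Equiv.swap_apply_right, sub_zero]
      by_cases hC : C
      · have := hdi hC
        have := hσ hC
        simp only [hC, true_and]
        split_ifs <;> omega
      · simp [hC]
    · have := h.nonneg hρ' q
      omega

end Contrapolymatroid

section PermInduction

variable {n : ℕ}

lemma perm_swap_induction {P : Equiv.Perm (Fin n) → Prop}
    (step : ∀ w : Equiv.Perm (Fin n),
      (∀ p k, p < k → w p < w k → P (w * Equiv.swap p k)) → P w) (w : Equiv.Perm (Fin n)) : P w := by
  obtain ⟨N, hN⟩ : ∃ N : ℕ, ∑ i : Fin n, (i : ℕ) * (w i : ℕ) < N := ⟨_, Nat.lt_succ_self _⟩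
  induction N generalizing w with
  | zero => omega
  | succ N ih =>
    refine step w fun p k hpk hw => ih _ (lt_of_lt_of_le ?_ (Nat.lt_succ_iff.mp hN))
    have hk : k ∈ Finset.univ.erase p := by simp [hpk.ne']
    rw [← Finset.add_sum_erase _ _ (Finset.mem_univ p), ← Finset.add_sum_erase _ _ hk,
      ← Finset.add_sum_erase _ (fun i : Fin n => (i : ℕ) * (w i : ℕ)) (Finset.mem_univ p),
      ← Finset.add_sum_erase _ (fun i : Fin n => (i : ℕ) * (w i : ℕ)) hk]
    have hrest : ∑ i ∈ (Finset.univ.erase p).erase k,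
        (i : ℕ) * ((w * Equiv.swap p k) i : ℕ) =
        ∑ i ∈ (Finset.univ.erase p).erase k, (i : ℕ) * (w i : ℕ) :=
      Finset.sum_congr rfl fun i hi => by
        simp only [Finset.mem_erase, Finset.mem_univ, and_true] at hi
        rw [Equiv.Perm.mul_apply, Equiv.swap_apply_of_ne_of_ne hi.2 hi.1]
    rw [hrest, Equiv.Perm.mul_apply, Equiv.Perm.mul_apply, Equiv.swap_apply_left,
      Equiv.swap_apply_right]
    have h1 : (p : ℕ) < k := hpk
    have h2 : (w p : ℕ) < w k := hw
    nlinarith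

lemma lt_of_forall_descent {w : Equiv.Perm (Fin n)} {a b : Fin n} (hab : a < b)
    (h : ∀ j j' : Fin n, (j' : ℕ) = j + 1 → a ≤ j → j' ≤ b → w j' < w j) : w b < w a := by
  obtain ⟨d, hd⟩ : ∃ d : ℕ, (b : ℕ) = a + (d + 1) := ⟨b - a - 1, by
    have : (a : ℕ) < b := hab
    omega⟩
  induction d generalizing b with
  | zero => exact h a b hd le_rfl le_rfl
  | succ d ih =>
    have hb := b.isLt
    let c : Fin n := ⟨a + (d + 1), by omega⟩
    have hcb : c ≤ b := by rw [Fin.le_def]; simp only [c]; omega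
    refine (h c b (by simp only [c]; omega) (by rw [Fin.le_def]; simp only [c]; omega) le_rfl).trans
      (ih (b := c) (by rw [Fin.lt_def]; simp only [c]; omega)
        (fun j j' hj ha hj' => h j j' hj ha (hj'.trans hcb)) rfl)

lemma eq_revPerm_of_forall_descent {w : Equiv.Perm (Fin n)}
    (h : ∀ j j' : Fin n, (j' : ℕ) = j + 1 → w j' < w j) : w = Fin.revPerm := by
  have hanti : StrictAnti w := fun a b hab => lt_of_forall_descent hab fun j j' hj _ _ => h j j' hj
  refine Equiv.coe_inj.mp ((hanti.range_inj Fin.rev_strictAnti).mp ?_)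
  rw [w.surjective.range_eq, Fin.rev_surjective.range_eq]

lemma exists_first_ascent {w : Equiv.Perm (Fin n)} (hw : w ≠ Fin.revPerm) :
    ∃ p p' : Fin n, (p' : ℕ) = p + 1 ∧ w p < w p' ∧ ∀ t < p, w p < w t := by
  have hex : ∃ p : ℕ, ∃ j j' : Fin n, (j : ℕ) = p ∧ (j' : ℕ) = j + 1 ∧ w j < w j' := by
    by_contra! h
    refine hw (eq_revPerm_of_forall_descent fun j j' hj => ?_)
    refine lt_of_le_of_ne (h j j j' rfl hj) fun he => ?_
    have := w.injective he
    subst this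
    omega
  obtain ⟨j, j', hj, hj', hlt⟩ := Nat.find_spec hex
  refine ⟨j, j', hj', hlt, fun t ht => lt_of_forall_descent ht fun a a' ha _ ha' => ?_⟩
  have h1 : (a' : ℕ) ≤ j := ha'
  refine lt_of_le_of_ne (not_lt.mp fun h => Nat.find_min hex (m := a) (by omega)
    ⟨a, a', rfl, ha, h⟩) fun he => ?_
  have := w.injective he
  subst this
  omega

end PermInduction

section Schubert

variable {n : ℕ} {S : Equiv.Perm (Fin n) → MvPolynomial (Fin n) ℤ}

lemma ne_of_adjacent {j j' : Fin n} (hj : (j' : ℕ) = j + 1) : j ≠ j' := by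
  rintro rfl
  omega

lemma X_sub_X_ne_zero {j j' : Fin n} (hj : (j' : ℕ) = j + 1) :
    (X j - X j' : MvPolynomial (Fin n) ℤ) ≠ 0 :=
  sub_ne_zero.mpr fun h => ne_of_adjacent hj (X_injective h)

lemma rename_swap_rename_swap (i j : Fin n) (f : MvPolynomial (Fin n) ℤ) :
    rename (Equiv.swap i j) (rename (Equiv.swap i j) f) = f := by
  rw [rename_rename]
  have : (Equiv.swap i j : Fin n → Fin n) ∘ Equiv.swap i j = id := by funext k; simp
  rw [this, rename_id_apply]

lemma IsSchubertFamily.ascent (hS : IsSchubertFamily S) {w : Equiv.Perm (Fin n)} {j j' : Fin n}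
    (hj : (j' : ℕ) = j + 1) (hw : w j < w j') : (X j - X j') * S w =
      S (w * Equiv.swap j j') - rename (Equiv.swap j j') (S (w * Equiv.swap j j')) := by
  have := hS.2 (w * Equiv.swap j j') j j' hj (by simpa using hw)
  rwa [mul_assoc, Equiv.swap_mul_self, mul_one] at this

lemma IsGrothendieckFamily.ascent {G : Equiv.Perm (Fin n) → MvPolynomial (Fin n) ℤ}
    (hG : IsGrothendieckFamily G) {w : Equiv.Perm (Fin n)} {j j' : Fin n}
    (hj : (j' : ℕ) = j + 1) (hw : w j < w j') : (X j - X j') * G w =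
      (1 - X j') * G (w * Equiv.swap j j') -
        rename (Equiv.swap j j') ((1 - X j') * G (w * Equiv.swap j j')) := by
  have := hG.2 (w * Equiv.swap j j') j j' hj (by simpa using hw)
  rwa [mul_assoc, Equiv.swap_mul_self, mul_one] at this

lemma IsSchubertFamily.rename_swap (hS : IsSchubertFamily S) {w : Equiv.Perm (Fin n)}
    {j j' : Fin n} (hj : (j' : ℕ) = j + 1) (hw : w j < w j') :
    rename (Equiv.swap j j') (S w) = S w := by
  have h := hS.ascent hj hw
  have h2 := congrArg (rename (Equiv.swap j j')) h
  rw [map_mul, map_sub, map_sub, rename_swap_rename_swap, rename_X, rename_X,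
    Equiv.swap_apply_left, Equiv.swap_apply_right] at h2
  refine mul_left_cancel₀ (X_sub_X_ne_zero hj) ?_
  linear_combination -h2 - h

lemma prod_X_pow_eq (d : Fin n → ℕ) : ∏ i : Fin n, (X i : MvPolynomial (Fin n) ℤ) ^ d i =
    monomial (Finsupp.equivFunOnFinite.symm d) 1 := by
  rw [monomial_eq, C_1, one_mul, Finsupp.prod_fintype _ _ fun i => pow_zero _]
  rfl

lemma intCoeff_prod_X_pow (d : Fin n → ℕ) (x : Fin n → ℤ) :
    intCoeff (∏ i : Fin n, X i ^ d i) x = if x = fun i => (d i : ℤ) then 1 else 0 := by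
  rw [prod_X_pow_eq, intCoeff, coeffSum_monomial]
  simp [eq_comm]

lemma cumCoeff_prod_X_pow (d : Fin n → ℕ) (x : Fin n → ℤ) :
    cumCoeff (∏ i : Fin n, X i ^ d i) x = if (fun i => (d i : ℤ)) ≤ x then 1 else 0 := by
  rw [prod_X_pow_eq, cumCoeff, coeffSum_monomial]
  simp

lemma eq_of_intCoeff_eq {f g : MvPolynomial (Fin n) ℤ} (h : ∀ x, intCoeff f x = intCoeff g x) :
    f = g := by
  ext m
  rw [← intCoeff_natCast, ← intCoeff_natCast, h]

/-- The exponent of `x_i` in a monomial of a Schubert polynomial for `S_n` is at most `n - i`. -/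
lemma IsSchubertFamily.le_rev (hS : IsSchubertFamily S) (w : Equiv.Perm (Fin n)) {x : Fin n → ℤ}
    (hx : intCoeff (S w) x ≠ 0) (i : Fin n) : x i ≤ (Fin.rev i : ℕ) := by
  induction w using perm_swap_induction generalizing x i with
  | step w ih =>
    by_cases hw : w = Fin.revPerm
    · rw [hw, hS.1, intCoeff_prod_X_pow] at hx
      simp only [ne_eq, ite_eq_right_iff, one_ne_zero, imp_false, not_not] at hx
      rw [hx]
    obtain ⟨j, j', hj, hlt, -⟩ := exists_first_ascent hw
    have hne := ne_of_adjacent hj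
    have hd := isDividedDiff_intCoeff (hS.ascent hj hlt)
    have hneg : ∀ x k, x k < 0 → intCoeff (S w) x = 0 := fun x k hk => intCoeff_of_neg _ hk
    have hjj : j < j' := by rw [Fin.lt_def]; omega
    have key : ∀ x, intCoeff (S w) x ≠ 0 → x j ≤ (Fin.rev j' : ℕ) := by
      intro x hx
      obtain ⟨k, y, hy, -, h⟩ := hd.exists_ne_zero hne (fun x hx => hneg x j' hx) hx
      have h1 := ih j j' hjj hlt hy j
      have h2 := ih j j' hjj hlt hy j'
      simp only [Fin.val_rev] at h1 h2 ⊢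
      omega
    have h1 := key x hx
    have h2 := key (x ∘ Equiv.swap j j') (by rwa [hd.symm hne hneg])
    simp at h1 h2
    by_cases hij : i = j
    · subst hij
      simp
      omega
    by_cases hij' : i = j'
    · subst hij'
      simpa using h2
    obtain ⟨k, y, hy, h, -⟩ := hd.exists_ne_zero hne (fun x hx => hneg x j' hx) hx
    rw [← h i hij hij']
    exact ih j j' hjj hlt hy i

/-- If all the values of `w` on the positions up to `p` exceed all the later ones, then the first
`p` variables have large exponents in all monomials of the Schubert polynomial of `w`. -/
lemma IsSchubertFamily.rev_le (hS : IsSchubertFamily S) (w : Equiv.Perm (Fin n)) {p : Fin n}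
    (hp : ∀ i ≤ p, ∀ k, p < k → w k < w i) {x : Fin n → ℤ} (hx : intCoeff (S w) x ≠ 0) {i : Fin n}
    (hi : i ≤ p) : ((Fin.rev p : ℕ) : ℤ) ≤ x i := by
  induction w using perm_swap_induction generalizing x i with
  | step w ih =>
    by_cases hw : w = Fin.revPerm
    · rw [hw, hS.1, intCoeff_prod_X_pow] at hx
      simp only [ne_eq, ite_eq_right_iff, one_ne_zero, imp_false, not_not] at hx
      rw [hx, Nat.cast_le]
      exact_mod_cast Fin.rev_le_rev.mpr hi
    obtain ⟨j, j', hj, hlt, -⟩ := exists_first_ascent hw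
    have hne := ne_of_adjacent hj
    have hd := isDividedDiff_intCoeff (hS.ascent hj hlt)
    have hneg : ∀ x k, x k < 0 → intCoeff (S w) x = 0 := fun x k hk => intCoeff_of_neg _ hk
    have hjj : j < j' := by rw [Fin.lt_def]; omega
    have hjp : j ≠ p := by
      rintro rfl
      exact absurd (hp j le_rfl j' hjj) hlt.asymm
    have hs : ∀ t, Equiv.swap j j' t ≤ p ↔ t ≤ p := by
      intro t
      rw [Equiv.swap_apply_def]
      split_ifs <;> omega
    have ih' := fun {x} (hx : intCoeff (S (w * Equiv.swap j j')) x ≠ 0) {i} hi =>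
      ih j j' hjj hlt (fun i hi k hk => by
        rw [Equiv.Perm.mul_apply, Equiv.Perm.mul_apply]
        exact hp _ ((hs i).mpr hi) _ (not_le.mp fun h => not_le.mpr hk ((hs k).mp h))) hx (i := i) hi
    have key : ∀ x, intCoeff (S w) x ≠ 0 → j' ≤ p → ((Fin.rev p : ℕ) : ℤ) ≤ x j' := by
      intro x hx hj'
      obtain ⟨k, y, hy, -, h⟩ := hd.exists_ne_zero hne (fun x hx => hneg x j' hx) hx
      have h1 := ih' hy (hjj.le.trans hj')
      have h2 := ih' hy hj'
      omega
    by_cases hij : i = j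
    · subst hij
      simpa using key (x ∘ Equiv.swap i j') (by rwa [hd.symm hne hneg]) (by omega)
    by_cases hij' : i = j'
    · subst hij'
      exact key x hx hi
    obtain ⟨k, y, hy, h, -⟩ := hd.exists_ne_zero hne (fun x hx => hneg x j' hx) hx
    rw [← h i hij hij']
    exact ih' hy hi

lemma IsSchubertFamily.sub_rename_swap (hS : IsSchubertFamily S) (z : Equiv.Perm (Fin n))
    {j j' : Fin n} (hj : (j' : ℕ) = j + 1) : S z - rename (Equiv.swap j j') (S z) =
      (X j - X j') * if z j' < z j then S (z * Equiv.swap j j') else 0 := by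
  split_ifs with h
  · exact (hS.2 z j j' hj h).symm
  · have hne : z j ≠ z j' := fun he => ne_of_adjacent hj (z.injective he)
    rw [hS.rename_swap hj (lt_of_le_of_ne (not_lt.mp h) hne), sub_self, mul_zero]

/-- The relation that `w * swap p k` covers `w` in the Bruhat order, where `p < k`. -/
def IsBruhatCover (w : Equiv.Perm (Fin n)) (p k : Fin n) : Prop :=
  p < k ∧ w p < w k ∧ ∀ t, p < t → t < k → ¬ (w p < w t ∧ w t < w k)

lemma isBruhatCover_mul_swap_iff {w : Equiv.Perm (Fin n)} {j j' p : Fin n}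
    (hj : (j' : ℕ) = j + 1) (hw : w j < w j') (hpj : p ≠ j) (hpj' : p ≠ j') (k : Fin n) :
    (IsBruhatCover (w * Equiv.swap j j') p k ∧
      (w * Equiv.swap j j' * Equiv.swap p k) j' < (w * Equiv.swap j j' * Equiv.swap p k) j) ↔
    IsBruhatCover w p (Equiv.swap j j' k) := by
  have hne := ne_of_adjacent hj
  have hpjn : (p : ℕ) ≠ j := fun h => hpj (Fin.ext h)
  have hpjn' : (p : ℕ) ≠ j' := fun h => hpj' (Fin.ext h)
  have hsp : Equiv.swap j j' p = p := Equiv.swap_apply_of_ne_of_ne hpj hpj'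
  have hs : ∀ t, (t = j ∧ Equiv.swap j j' t = j') ∨ (t = j' ∧ Equiv.swap j j' t = j) ∨
      (t ≠ j ∧ t ≠ j' ∧ Equiv.swap j j' t = t) := by
    intro t
    rw [Equiv.swap_apply_def]
    split_ifs <;> simp_all
  simp only [IsBruhatCover, Equiv.Perm.mul_apply, hsp]
  have hlt : ∀ t, p < Equiv.swap j j' t ↔ p < t := fun t => by
    rcases hs t with ⟨h, h'⟩ | ⟨h, h'⟩ | ⟨-, -, h'⟩ <;> rw [h'] <;> subst_vars <;>
      simp only [Fin.lt_def] <;> omega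
  have hall : ∀ Q : Fin n → Prop, (∀ t, Q t) ↔ ∀ t, Q (Equiv.swap j j' t) :=
    fun Q => ((Equiv.swap j j').forall_congr_left (p := Q)).trans (by simp)
  rw [hlt, hall fun t => p < t → t < Equiv.swap j j' k → _]
  simp only [hlt]
  rcases hs k with ⟨rfl, h'⟩ | ⟨rfl, h'⟩ | ⟨h1, h2, h'⟩
  · have hkj : w k ≠ w p := fun h => hpj (w.injective h).symm
    rw [h', Equiv.swap_apply_of_ne_of_ne hpj'.symm hne.symm, Equiv.swap_apply_right,
      Equiv.swap_apply_right, hsp]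
    constructor
    · rintro ⟨⟨h1, h2, h3⟩, h4⟩
      refine ⟨h1, h2, fun t ht ht' hw' => ?_⟩
      rcases hs t with ⟨h, h''⟩ | ⟨h, h''⟩ | ⟨ha, hb, h''⟩ <;> rw [h''] at ht' hw'
      · exact lt_irrefl _ ht'
      · exact hw'.1.asymm h4
      · have ha' : (t : ℕ) ≠ k := fun h => ha (Fin.ext h)
        exact h3 t ht (by rw [Fin.lt_def] at ht' ⊢; omega) (by rwa [h''])
    · rintro ⟨h1, h2, h3⟩
      refine ⟨⟨h1, h2, fun t ht ht' => h3 t ht ?_⟩, ?_⟩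
      · rw [Equiv.swap_apply_of_ne_of_ne ht'.ne (by rintro rfl; rw [Fin.lt_def] at ht'; omega)]
        rw [Fin.lt_def] at ht' ⊢
        omega
      · have := h3 j' (by rw [Fin.lt_def] at h1 ⊢; omega)
          (by rw [Equiv.swap_apply_right, Fin.lt_def]; omega)
        rw [Equiv.swap_apply_right] at this
        exact lt_of_le_of_ne (not_lt.mp fun h => this ⟨h, hw⟩) hkj
  · rw [h', Equiv.swap_apply_right, hsp, Equiv.swap_apply_of_ne_of_ne hpj.symm hne,
      Equiv.swap_apply_left]
    constructor
    · rintro ⟨⟨h1, h2, h3⟩, -⟩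
      refine ⟨h1, h2, fun t ht ht' => h3 t ht ?_⟩
      rcases hs t with ⟨h, h''⟩ | ⟨h, h''⟩ | ⟨ha, hb, h''⟩ <;> rw [h''] at ht'
      · exact absurd ht' (by rw [Fin.lt_def]; omega)
      · exact absurd ht' (lt_irrefl _)
      · rw [Fin.lt_def] at ht' ⊢
        omega
    · rintro ⟨h1, h2, h3⟩
      refine ⟨⟨h1, h2, fun t ht ht' hw' => ?_⟩, h2.trans hw⟩
      rcases hs t with ⟨h, h''⟩ | ⟨h, h''⟩ | ⟨ha, hb, h''⟩
      · rw [h''] at hw'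
        exact hw'.2.asymm hw
      · exact ht'.ne h
      · have ha' : (t : ℕ) ≠ j := fun h => ha (Fin.ext h)
        refine h3 t ht ?_ hw'
        rw [h'']
        rw [Fin.lt_def] at ht' ⊢
        omega
  · have hlt' : ∀ t, Equiv.swap j j' t < k ↔ t < k := fun t => by
      rcases hs t with ⟨h, h'⟩ | ⟨h, h'⟩ | ⟨-, -, h'⟩ <;> rw [h'] <;> subst_vars <;>
      simp only [Fin.lt_def] <;> omega
    rw [h', Equiv.swap_apply_of_ne_of_ne hpj.symm h1.symm,
      Equiv.swap_apply_of_ne_of_ne hpj'.symm h2.symm, Equiv.swap_apply_left,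
      Equiv.swap_apply_right]
    simp only [hlt', hw, and_true]

/-- The sum of the Schubert polynomials of the Bruhat covers of `w` at position `p`. -/
def coverSum (S : Equiv.Perm (Fin n) → MvPolynomial (Fin n) ℤ) (w : Equiv.Perm (Fin n))
    (p : Fin n) : MvPolynomial (Fin n) ℤ :=
  ∑ k ∈ Finset.univ.filter (IsBruhatCover w p), S (w * Equiv.swap p k)

lemma IsSchubertFamily.X_mul_of_ascent_ne (hS : IsSchubertFamily S) {w : Equiv.Perm (Fin n)}
    {j j' p : Fin n} (hj : (j' : ℕ) = j + 1) (hw : w j < w j') (hpj : p ≠ j) (hpj' : p ≠ j')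
    (ih : X p * S (w * Equiv.swap j j') = coverSum S (w * Equiv.swap j j') p) :
    X p * S w = coverSum S w p := by
  refine mul_left_cancel₀ (X_sub_X_ne_zero hj) ?_
  have hsp : Equiv.swap j j' p = p := Equiv.swap_apply_of_ne_of_ne hpj hpj'
  have h1 : (X j - X j') * (X p * S w) = coverSum S (w * Equiv.swap j j') p -
      rename (Equiv.swap j j') (coverSum S (w * Equiv.swap j j') p) := by
    rw [← ih, map_mul, rename_X, hsp]
    linear_combination X p * hS.ascent hj hw
  rw [h1, coverSum, map_sum, ← Finset.sum_sub_distrib,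
    Finset.sum_congr rfl fun k _ => hS.sub_rename_swap _ hj, ← Finset.mul_sum,
    ← Finset.sum_filter, Finset.filter_filter, coverSum]
  congr 1
  refine Finset.sum_equiv (Equiv.swap j j') (fun k => ?_) fun k hk => ?_
  · simp only [Finset.mem_filter, Finset.mem_univ, true_and]
    exact isBruhatCover_mul_swap_iff hj hw hpj hpj' k
  · congr 1
    rw [mul_assoc w, Equiv.mul_swap_eq_swap_mul (Equiv.swap j j') p k, hsp, mul_assoc, mul_assoc,
      Equiv.swap_mul_self, mul_one]

lemma IsSchubertFamily.X_mul_of_ascent_eq (hS : IsSchubertFamily S) {w : Equiv.Perm (Fin n)}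
    {p p' : Fin n} (hp : (p' : ℕ) = p + 1) (hw : w p < w p') (hlr : ∀ t < p, w p < w t)
    (hdesc : ∀ a b, p' ≤ a → a < b → w b < w a)
    (ih : (∀ t < p', (w * Equiv.swap p p') p' < (w * Equiv.swap p p') t) →
      (∃ k, p' < k ∧ (w * Equiv.swap p p') p' < (w * Equiv.swap p p') k) →
      X p' * S (w * Equiv.swap p p') = coverSum S (w * Equiv.swap p p') p') :
    X p * S w = coverSum S w p := by
  have hne := ne_of_adjacent hp
  have hpp : p < p' := by rw [Fin.lt_def]; omega
  have hlt : ∀ t, p < t ↔ p' = t ∨ p' < t := fun t => by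
    simp only [Fin.lt_def, Fin.ext_iff]
    omega
  have hlt' : ∀ t, t < p' ↔ t = p ∨ t < p := fun t => by
    simp only [Fin.lt_def, Fin.ext_iff]
    omega
  have hup : (w * Equiv.swap p p') p = w p' := by simp
  have hup' : (w * Equiv.swap p p') p' = w p := by simp
  have hu : ∀ t, t ≠ p → t ≠ p' → (w * Equiv.swap p p') t = w t := fun t h1 h2 => by
    simp [Equiv.swap_apply_of_ne_of_ne h1 h2]
  have hugt : ∀ t, p' < t → (w * Equiv.swap p p') t = w t := fun t ht =>
    hu t (hpp.trans ht).ne' ht.ne'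
  have hult : ∀ t, t < p → (w * Equiv.swap p p') t = w t := fun t ht =>
    hu t ht.ne (ht.trans hpp).ne
  have hcov : ∀ k, IsBruhatCover w p k ↔ p < k ∧ w p < w k := fun k => by
    refine ⟨fun h => ⟨h.1, h.2.1⟩, fun h => ⟨h.1, h.2, fun t ht htk hwt => ?_⟩⟩
    refine (hdesc t k ?_ htk).asymm hwt.2
    rcases (hlt t).mp ht with rfl | h
    · exact le_rfl
    · exact h.le
  refine mul_left_cancel₀ (X_sub_X_ne_zero hp) ?_
  have h1 : (X p - X p') * (X p * S w) = (X p - X p') * S (w * Equiv.swap p p') +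
      (X p' * S (w * Equiv.swap p p') -
        rename (Equiv.swap p p') (X p' * S (w * Equiv.swap p p'))) := by
    rw [map_mul, rename_X, Equiv.swap_apply_right]
    linear_combination X p * hS.ascent hp hw
  rw [h1]
  by_cases hex : ∃ k, p' < k ∧ w p < w k
  · have hcov' : ∀ k, IsBruhatCover (w * Equiv.swap p p') p' k ↔ p' < k ∧ w p < w k := fun k => by
      constructor
      · rintro ⟨h1, h2, -⟩
        rw [hup', hugt k h1] at h2
        exact ⟨h1, h2⟩
      · rintro ⟨h1, h2⟩
        refine ⟨h1, by rwa [hup', hugt k h1], fun t ht htk hwt => ?_⟩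
        rw [hugt t ht, hugt k h1] at hwt
        exact (hdesc t k ht.le htk).asymm hwt.2
    rw [ih ?_ ?_, coverSum, map_sum, ← Finset.sum_sub_distrib,
      Finset.sum_congr rfl fun k _ => hS.sub_rename_swap _ hp, ← Finset.mul_sum, ← mul_add]
    · congr 1
      have hset : Finset.univ.filter (IsBruhatCover w p) =
          insert p' (Finset.univ.filter (IsBruhatCover (w * Equiv.swap p p') p')) := by
        ext k
        simp only [Finset.mem_filter, Finset.mem_univ, true_and, Finset.mem_insert, hcov, hcov',
          hlt]
        constructor
        · rintro ⟨rfl | h, h'⟩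
          · exact Or.inl rfl
          · exact Or.inr ⟨h, h'⟩
        · rintro (rfl | h)
          · exact ⟨Or.inl rfl, hw⟩
          · exact ⟨Or.inr h.1, h.2⟩
      rw [coverSum, hset, Finset.sum_insert (by simp [hcov'])]
      congr 1
      refine Finset.sum_congr rfl fun k hk => ?_
      simp only [Finset.mem_filter, Finset.mem_univ, true_and, hcov'] at hk
      have hkp : p ≠ k := (hpp.trans hk.1).ne
      rw [if_pos]
      · rw [mul_assoc w, Equiv.mul_swap_eq_swap_mul (Equiv.swap p p') p' k,
          Equiv.swap_apply_right, Equiv.swap_apply_of_ne_of_ne hkp.symm hk.1.ne', mul_assoc,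
          mul_assoc, Equiv.swap_mul_self, mul_one]
      · rw [Equiv.Perm.mul_apply (w * Equiv.swap p p'), Equiv.Perm.mul_apply (w * Equiv.swap p p'),
          Equiv.swap_apply_left, Equiv.swap_apply_of_ne_of_ne hne hkp, hup, hugt k hk.1]
        exact hdesc p' k le_rfl hk.1
    · intro t ht
      rw [hup']
      rcases (hlt' t).mp ht with rfl | ht
      · rwa [hup]
      · rw [hult t ht]
        exact hlr t ht
    · obtain ⟨k, hk, hk'⟩ := hex
      exact ⟨k, hk, by rwa [hup', hugt k hk]⟩
  · have hbig : ∀ k, p' < k → w k < w p := fun k hk =>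
      lt_of_le_of_ne (not_lt.mp fun h => hex ⟨k, hk, h⟩) fun h =>
        (hpp.trans hk).ne' (w.injective h)
    have hb : ∀ i ≤ p, ∀ k, p < k → (w * Equiv.swap p p') k < (w * Equiv.swap p p') i := by
      intro i hi k hk
      have h1 : (w * Equiv.swap p p') k ≤ w p := by
        rcases (hlt k).mp hk with rfl | hk
        · exact hup'.le
        · rw [hugt k hk]
          exact (hbig k hk).le
      rcases hi.eq_or_lt with rfl | hi
      · rw [hup]
        exact h1.trans_lt hw
      · rw [hult i hi]
        exact h1.trans_lt (hlr i hi)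
    have hb' : ∀ i ≤ p', ∀ k, p' < k → (w * Equiv.swap p p') k < (w * Equiv.swap p p') i := by
      intro i hi k hk
      rcases hi.eq_or_lt with rfl | hi
      · rw [hup', hugt k hk]
        exact hbig k hk
      · exact hb i (by rcases (hlt' i).mp hi with rfl | h; exacts [le_rfl, h.le]) k (hpp.trans hk)
    have hval : ∀ x, intCoeff (X p' * S (w * Equiv.swap p p')) x ≠ 0 → x p = x p' := by
      intro x hx
      rw [intCoeff_X_mul] at hx
      have a1 := hS.rev_le _ hb hx le_rfl
      have a2 := hS.rev_le _ hb' hx le_rfl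
      have a3 := hS.le_rev _ hx p
      have a4 := hS.le_rev _ hx p'
      have := p'.isLt
      simp only [Pi.sub_apply, Pi.single_eq_same, Pi.single_eq_of_ne hne, Fin.val_rev] at a1 a2 a3 a4
      omega
    have hswap : ∀ x : Fin n → ℤ, x p = x p' → x ∘ Equiv.swap p p' = x := fun x hx => by
      funext t
      by_cases ht : t = p
      · simp [ht, hx]
      by_cases ht' : t = p'
      · simp [ht', hx]
      simp [Equiv.swap_apply_of_ne_of_ne ht ht']
    have hsymm : rename (Equiv.swap p p') (X p' * S (w * Equiv.swap p p')) =
        X p' * S (w * Equiv.swap p p') := by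
      refine eq_of_intCoeff_eq fun x => ?_
      rw [intCoeff_rename_swap]
      by_cases hx : x p = x p'
      · rw [hswap x hx]
      · rw [not_ne_iff.mp (mt (hval x) hx), not_ne_iff.mp (mt (hval _) (by simpa using Ne.symm hx))]
    rw [hsymm, sub_self, add_zero, coverSum]
    have hset : Finset.univ.filter (IsBruhatCover w p) = {p'} := by
      ext k
      simp only [Finset.mem_filter, Finset.mem_univ, true_and, Finset.mem_singleton, hcov, hlt]
      constructor
      · rintro ⟨rfl | h, h'⟩
        · rfl
        · exact absurd h' (hbig k h).asymm
      · rintro rfl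
        exact ⟨Or.inl rfl, hw⟩
    rw [hset, Finset.sum_singleton]

/-- The cotransition formula for Schubert polynomials, at a left-to-right minimum. -/
theorem IsSchubertFamily.X_mul_eq_coverSum (hS : IsSchubertFamily S) (w : Equiv.Perm (Fin n))
    (p : Fin n) (hlr : ∀ t < p, w p < w t) (hex : ∃ k, p < k ∧ w p < w k) :
    X p * S w = coverSum S w p := by
  induction w using perm_swap_induction generalizing p with
  | step w ih =>
    by_cases hasc : ∃ j j' : Fin n, (j' : ℕ) = j + 1 ∧ w j < w j' ∧ j ≠ p
    · obtain ⟨j, j', hj, hw, hjp⟩ := hasc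
      have hjj : j < j' := by rw [Fin.lt_def]; omega
      have hjp' : p ≠ j' := by
        rintro rfl
        exact (hlr j hjj).asymm hw
      have hv := fun h : (p : ℕ) = j' => hjp' (Fin.ext h)
      have hv' := fun h : (j : ℕ) = p => hjp (Fin.ext h)
      have hsp : Equiv.swap j j' p = p := Equiv.swap_apply_of_ne_of_ne hjp.symm hjp'
      refine hS.X_mul_of_ascent_ne hj hw hjp.symm hjp' (ih j j' hjj hw p (fun t ht => ?_) ?_)
      · rw [Equiv.Perm.mul_apply, Equiv.Perm.mul_apply, hsp]
        refine hlr _ ?_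
        rw [Equiv.swap_apply_def]
        simp only [Fin.lt_def] at ht ⊢
        split_ifs <;> subst_vars <;> omega
      · obtain ⟨k, hk, hk'⟩ := hex
        refine ⟨Equiv.swap j j' k, ?_, ?_⟩
        · rw [Equiv.swap_apply_def]
          simp only [Fin.lt_def] at hk ⊢
          split_ifs <;> subst_vars <;> omega
        · rw [Equiv.Perm.mul_apply, Equiv.Perm.mul_apply, hsp, Equiv.swap_apply_self]
          exact hk'
    · have hdesc : ∀ a b : Fin n, p < a → a < b → w b < w a := fun a b ha hab =>
        lt_of_forall_descent hab fun j j' hj haj _ => by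
          refine lt_of_le_of_ne (not_lt.mp fun h => hasc ⟨j, j', hj, h, (ha.trans_le haj).ne'⟩)
            fun h => ne_of_adjacent hj (w.injective h).symm
      obtain ⟨k, hk, hk'⟩ := hex
      obtain ⟨p', hp⟩ : ∃ p' : Fin n, (p' : ℕ) = p + 1 := ⟨⟨p + 1, by omega⟩, rfl⟩
      have hpp : p < p' := by rw [Fin.lt_def]; omega
      have hw : w p < w p' := by
        rcases (show p' ≤ k by rw [Fin.le_def]; omega).eq_or_lt with rfl | h
        · exact hk'
        · exact hk'.trans (hdesc p' k hpp h)
      exact hS.X_mul_of_ascent_eq hp hw hlr (fun a b ha hab => hdesc a b (hpp.trans_le ha) hab)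
        (ih p p' hpp hw p')

lemma intCoeff_coverSum (w : Equiv.Perm (Fin n)) (p : Fin n) (x : Fin n → ℤ) :
    intCoeff (coverSum S w p) x =
      ∑ k ∈ Finset.univ.filter (IsBruhatCover w p), intCoeff (S (w * Equiv.swap p k)) x := by
  rw [intCoeff, coverSum, map_sum]
  rfl

lemma IsSchubertFamily.nonneg (hS : IsSchubertFamily S) (w : Equiv.Perm (Fin n))
    (x : Fin n → ℤ) : 0 ≤ intCoeff (S w) x := by
  induction w using perm_swap_induction generalizing x with
  | step w ih =>
    by_cases hw : w = Fin.revPerm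
    · rw [hw, hS.1, intCoeff_prod_X_pow]
      split_ifs <;> simp
    obtain ⟨p, p', hp, hlt, hlr⟩ := exists_first_ascent hw
    have hpp : p < p' := by rw [Fin.lt_def]; omega
    have h := congrArg (fun f => intCoeff f (x + Pi.single p 1))
      (hS.X_mul_eq_coverSum w p hlr ⟨p', hpp, hlt⟩)
    simp only [intCoeff_X_mul, add_sub_cancel_right, intCoeff_coverSum] at h
    rw [h]
    refine Finset.sum_nonneg fun k hk => ?_
    simp only [Finset.mem_filter, Finset.mem_univ, true_and] at hk
    exact ih p k hk.1 hk.2.1 _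

/-- Multiplying by `x_p` at the first ascent `p` dominates the Schubert polynomial above. -/
lemma IsSchubertFamily.intCoeff_le (hS : IsSchubertFamily S) {w : Equiv.Perm (Fin n)}
    {p p' : Fin n} (hp : (p' : ℕ) = p + 1) (hlt : w p < w p') (hlr : ∀ t < p, w p < w t)
    (x : Fin n → ℤ) :
    intCoeff (S (w * Equiv.swap p p')) x ≤ intCoeff (S w) (x - Pi.single p 1) := by
  have hpp : p < p' := by rw [Fin.lt_def]; omega
  rw [← intCoeff_X_mul, hS.X_mul_eq_coverSum w p hlr ⟨p', hpp, hlt⟩, intCoeff_coverSum]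
  refine Finset.single_le_sum (f := fun k => intCoeff (S (w * Equiv.swap p k)) x)
    (fun k _ => hS.nonneg _ _) ?_
  simp only [Finset.mem_filter, Finset.mem_univ, true_and]
  refine ⟨hpp, hlt, fun t h1 h2 => ?_⟩
  rw [Fin.lt_def] at h1 h2
  omega

end Schubert

section Mobius

variable {n : ℕ}

lemma isAbove_sum_iff (d x : Fin n → ℤ) : IsAbove (fun T => ∑ i ∈ T, d i) x ↔ d ≤ x :=
  ⟨fun h i => by simpa using h {i}, fun h _ => Finset.sum_le_sum fun i _ => h i⟩

lemma isBase_sum_iff (d x : Fin n → ℤ) : IsBase (fun T => ∑ i ∈ T, d i) x ↔ x = d := by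
  rw [IsBase, isAbove_sum_iff]
  constructor
  · rintro ⟨h, hsum⟩
    funext i
    exact ((Finset.sum_eq_sum_iff_of_le fun i _ => h i).mp hsum.symm i (Finset.mem_univ i)).symm
  · rintro rfl
    exact ⟨le_rfl, rfl⟩

lemma isContrapolymatroid_sum {d : Fin n → ℤ} (hd : ∀ i, 0 ≤ d i) :
    IsContrapolymatroid fun T => ∑ i ∈ T, d i where
  singleton_nonneg i := by simpa using hd i
  supermodular _ _ := (Finset.sum_union_inter).ge
  attained _ := ⟨d, (isBase_sum_iff d d).mpr rfl, rfl⟩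

/-- The support of a multiplicity-free Schubert polynomial is the set of bases of a
contrapolymatroid `ρ`, and the coefficients of the Grothendieck polynomial below `x` add up
to one if `x` lies above `ρ`, and to zero otherwise. -/
theorem exists_isContrapolymatroid {S G : Equiv.Perm (Fin n) → MvPolynomial (Fin n) ℤ}
    (hS : IsSchubertFamily S) (hG : IsGrothendieckFamily G) (w : Equiv.Perm (Fin n))
    (hmf : ∀ x, intCoeff (S w) x ≤ 1) :
    ∃ ρ, IsContrapolymatroid ρ ∧ intCoeff (S w) = indicatorFun (IsBase ρ) ∧
      cumCoeff (G w) = indicatorFun (IsAbove ρ) := by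
  induction w using perm_swap_induction with
  | step w ih =>
    by_cases hw : w = Fin.revPerm
    · refine ⟨_, isContrapolymatroid_sum (d := fun i => ((Fin.rev i : ℕ) : ℤ))
        fun i => Int.natCast_nonneg _, funext fun x => ?_, funext fun x => ?_⟩
      · rw [hw, hS.1, intCoeff_prod_X_pow, indicatorFun_eq_of_iff (isBase_sum_iff _ x)]
      · rw [hw, hG.1, cumCoeff_prod_X_pow, indicatorFun_eq_of_iff (isAbove_sum_iff _ x)]
    obtain ⟨p, p', hp, hlt, hlr⟩ := exists_first_ascent hw
    have hle := fun x => hS.intCoeff_le hp hlt hlr x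
    obtain ⟨ρ, hρ, hb, ha⟩ := ih p p' (by rw [Fin.lt_def]; omega) hlt
      fun x => (hle x).trans (hmf _)
    have hd := isDividedDiff_intCoeff (hS.ascent hp hlt)
    have hi := isIsobaricDiff_cumCoeff (hG.ascent hp hlt)
    rw [hb] at hd
    rw [ha] at hi
    exact hρ.dividedDiff (ne_of_adjacent hp) hd hi (fun x k => intCoeff_of_neg _)
      (fun x k => cumCoeff_of_neg _) (hS.nonneg w) hmf fun x => hb ▸ hle x

lemma cumCoeff_natCast (f : MvPolynomial (Fin n) ℤ) (β : Fin n →₀ ℕ) :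
    cumCoeff f (fun i => (β i : ℤ)) = ∑ m ∈ f.support with m ≤ β, f.coeff m := by
  rw [cumCoeff, coeffSum_eq_sum, Finset.sum_filter]
  refine Finset.sum_congr rfl fun m _ => ?_
  simp [Pi.le_def, Finsupp.le_def]

lemma cumCoeff_eq_one_of_mem_support {f : MvPolynomial (Fin n) ℤ}
    {ρ : Finset (Fin n) → ℤ} (hf : cumCoeff f = indicatorFun (IsAbove ρ)) {α β : Fin n →₀ ℕ}
    (hα : α ∈ f.support) (hαβ : α ≤ β) : cumCoeff f (fun i => (β i : ℤ)) = 1 := by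
  have hmono : ∀ α β : Fin n →₀ ℕ, α ≤ β → IsAbove ρ (fun i => (α i : ℤ)) →
      IsAbove ρ (fun i => (β i : ℤ)) := fun α β h hα T =>
    (hα T).trans (Finset.sum_le_sum fun i _ => Nat.cast_le.mpr (h i))
  have habove : IsAbove ρ (fun i => (α i : ℤ)) := by
    induction α using WellFoundedLT.induction generalizing β with
    | ind α ih =>
      by_contra h
      have hzero : cumCoeff f (fun i => (α i : ℤ)) = 0 := by
        rw [hf]
        exact if_neg h
      rw [cumCoeff_natCast, Finset.sum_eq_single_of_mem α (by simp_all)] at hzero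
      · exact mem_support_iff.mp hα hzero
      · intro m hm hne
        rw [Finset.mem_filter] at hm
        exact absurd (hmono m α hm.2 (ih m (lt_of_le_of_ne hm.2 hne) hm.1 (hm.2.trans hαβ))) h
  rw [hf]
  exact if_pos (hmono α β hαβ habove)

lemma eq_zero_of_forall_sum_le_eq_zero {P : Finset (Fin n →₀ ℕ)} {ν : (Fin n →₀ ℕ) → ℤ}
    (h : ∀ β ∈ P, ∑ q ∈ P with q ≤ β, ν q = 0) (β : Fin n →₀ ℕ) (hβ : β ∈ P) : ν β = 0 := by
  induction β using WellFoundedLT.induction with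
  | ind β ih =>
    rw [← h β hβ, Finset.sum_eq_single_of_mem β (by simp [hβ])]
    intro q hq hne
    rw [Finset.mem_filter] at hq
    exact ih q (lt_of_le_of_ne hq.2 hne) hq.1

end Mobius

/-- Main theorem (Mészáros–Setiabrata–St. Dizier conjecture).  Let `w ∈ S_n` (`n ≥ 1`)
with `𝔖_w` multiplicity-free.  Let `γ` be the componentwise maximum of `supp 𝔊_w`,
let `Pw = P_w ∖ {0̂} = {β ∈ ℕ^n : α ≤ β ≤ γ for some α ∈ supp 𝔊_w}`, and let
`μ β = μ_w(0̂, β)` be the Möbius function of the poset `P_w` obtained from `Pw` by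
adjoining a minimum `0̂`; since `μ_w(0̂,0̂) = 1`, the Möbius recursion
`∑_{q ≤ p} μ_w(0̂,q) = 0` for `p ≠ 0̂` reads `1 + ∑_{q ∈ Pw, q ≤ β} μ q = 0` for
`β ∈ Pw`.  Then `𝔊_w = -∑_{β ∈ Pw} μ_w(0̂,β) x^β`. -/
theorem grothendieck_eq_neg_sum_mobius {n : ℕ} (hn : 1 ≤ n)
    (S G : Equiv.Perm (Fin n) → MvPolynomial (Fin n) ℤ)
    (hS : IsSchubertFamily S) (hG : IsGrothendieckFamily G)
    (w : Equiv.Perm (Fin n))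
    (hmf : ∀ m : Fin n →₀ ℕ, (S w).coeff m = 0 ∨ (S w).coeff m = 1)
    (γ : Fin n →₀ ℕ) (hγ : ∀ i : Fin n, γ i = (G w).support.sup (fun a => a i))
    (Pw : Finset (Fin n →₀ ℕ))
    (hPw : ∀ β : Fin n →₀ ℕ, β ∈ Pw ↔ ((∃ α ∈ (G w).support, α ≤ β) ∧ β ≤ γ))
    (μ : (Fin n →₀ ℕ) → ℤ)
    (hμ : ∀ β ∈ Pw, 1 + ∑ q ∈ Pw.filter (fun q => q ≤ β), μ q = 0) :
    G w = - ∑ β ∈ Pw, monomial β (μ β) := by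
  obtain ⟨ρ, -, -, hρ⟩ := exists_isContrapolymatroid hS hG w fun x => by
    by_cases hx : intCoeff (S w) x = 0
    · simp [hx]
    · obtain ⟨m, rfl⟩ := exists_natCast_of_intCoeff_ne_zero hx
      rw [intCoeff_natCast] at hx ⊢
      exact ((hmf m).resolve_left hx).le
  have hsub : (G w).support ⊆ Pw := fun α hα => (hPw α).mpr
    ⟨⟨α, hα, le_rfl⟩, fun i => (hγ i).symm ▸ Finset.le_sup (f := fun a : Fin n →₀ ℕ => a i) hα⟩
  have hcoeff : ∀ β ∈ Pw, μ β + (G w).coeff β = 0 := by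
    refine eq_zero_of_forall_sum_le_eq_zero fun β hβ => ?_
    obtain ⟨⟨α, hα, hαβ⟩, -⟩ := (hPw β).mp hβ
    have h1 := cumCoeff_eq_one_of_mem_support hρ hα hαβ
    rw [cumCoeff_natCast, Finset.sum_subset (Finset.filter_subset_filter _ hsub)
      fun m hm hm' => by simp_all] at h1
    rw [Finset.sum_add_distrib, h1, add_comm]
    exact hμ β hβ
  rw [(G w).as_sum, Finset.sum_subset hsub fun m _ hm => by simp_all, ← Finset.sum_neg_distrib]
  refine Finset.sum_congr rfl fun β hβ => ?_
  rw [eq_neg_of_add_eq_zero_left (hcoeff β hβ), map_neg, neg_neg]
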